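/- arXiv:1603.07657 — 12 statements merged into one kernel-verified Lean document; each statement's English description precedes it below -/
import Mathlib

section
/- For all nonnegative integers m, n and all complex numbers z, z', the monomial z^m z'^n has the expansion z^m z'^n = Σ_{j=0}^{min(m,n)} m! n! / (j! (m-j)! (n-j)!) · L_{m-j,n-j}(z,z') in terms of Laguerre 2D polynomials. -/
open Finset

/-- The Laguerre 2D polynomials. -/
noncomputable def L2D (m n : ℕ) (z z' : ℂ) : ℂ :=
  ∑ j ∈ Finset.range (min m n + 1),
    (-1 : ℂ) ^ j * (Nat.factorial m : ℂ) * (Nat.factorial n : ℂ) /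
      ((Nat.factorial j : ℂ) * (Nat.factorial (m - j) : ℂ) * (Nat.factorial (n - j) : ℂ)) *
      z ^ (m - j) * z' ^ (n - j)

/-- The alternating sum of inverse factorial products over the antidiagonal of `s` vanishes
unless `s = 0`. -/
lemma sum_neg_one_pow_div_factorial_mul_factorial (s : ℕ) :
    ∑ k ∈ Finset.range (s + 1),
      (-1 : ℂ) ^ (s - k) / ((Nat.factorial k : ℂ) * (Nat.factorial (s - k) : ℂ)) =
      if s = 0 then 1 else 0 := by
  have h := add_pow (1 : ℂ) (-1) s
  rw [add_neg_cancel, zero_pow_eq] at h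
  have hs : (Nat.factorial s : ℂ) ≠ 0 := Nat.cast_ne_zero.mpr s.factorial_ne_zero
  apply mul_left_cancel₀ hs
  rw [Finset.mul_sum]
  trans (if s = 0 then (1 : ℂ) else 0)
  · rw [h]
    refine Finset.sum_congr rfl fun k hk => ?_
    rw [Nat.cast_choose ℂ (Nat.lt_succ_iff.mp (Finset.mem_range.mp hk))]
    ring
  · split_ifs with h0 <;> simp [h0]

theorem monomial_expansion_in_L2D (m n : ℕ) (z z' : ℂ) :
    z ^ m * z' ^ n =
      ∑ j ∈ Finset.range (min m n + 1),
        (Nat.factorial m : ℂ) * (Nat.factorial n : ℂ) /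
          ((Nat.factorial j : ℂ) * (Nat.factorial (m - j) : ℂ) * (Nat.factorial (n - j) : ℂ)) *
          L2D (m - j) (n - j) z z' := by
  let f : ℕ → ℕ → ℂ := fun j i =>
    (Nat.factorial m : ℂ) * (Nat.factorial n : ℂ) * z ^ (m - (j + i)) * z' ^ (n - (j + i)) /
      ((Nat.factorial (m - (j + i)) : ℂ) * (Nat.factorial (n - (j + i)) : ℂ)) *
      ((-1 : ℂ) ^ i / ((Nat.factorial j : ℂ) * (Nat.factorial i : ℂ)))
  have hne (k : ℕ) : (Nat.factorial k : ℂ) ≠ 0 := Nat.cast_ne_zero.mpr k.factorial_ne_zero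
  have hexpand : ∀ j ∈ Finset.range (min m n + 1),
      (Nat.factorial m : ℂ) * (Nat.factorial n : ℂ) /
          ((Nat.factorial j : ℂ) * (Nat.factorial (m - j) : ℂ) * (Nat.factorial (n - j) : ℂ)) *
          L2D (m - j) (n - j) z z' =
        ∑ i ∈ Finset.range (min m n + 1 - j), f j i := by
    intro j hj
    have hj' := Finset.mem_range.mp hj
    have hrange : min (m - j) (n - j) + 1 = min m n + 1 - j := by omega
    rw [L2D, hrange, Finset.mul_sum]
    refine Finset.sum_congr rfl fun i _ => ?_
    have h1 := hne (m - j)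
    have h2 := hne (n - j)
    have h3 := hne (m - (j + i))
    have h4 := hne (n - (j + i))
    have h5 := hne i
    have h6 := hne j
    simp only [f, Nat.sub_sub]
    field_simp
  rw [Finset.sum_congr rfl hexpand, ← Finset.sum_range_diag_flip]
  have hdiag : ∀ s ∈ Finset.range (min m n + 1),
      ∑ k ∈ Finset.range (s + 1), f k (s - k) = if s = 0 then z ^ m * z' ^ n else 0 := by
    intro s _
    trans (Nat.factorial m : ℂ) * (Nat.factorial n : ℂ) * z ^ (m - s) * z' ^ (n - s) /
        ((Nat.factorial (m - s) : ℂ) * (Nat.factorial (n - s) : ℂ)) *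
        (if s = 0 then 1 else 0)
    · rw [← sum_neg_one_pow_div_factorial_mul_factorial, Finset.mul_sum]
      refine Finset.sum_congr rfl fun k hk => ?_
      simp only [f, Nat.add_sub_cancel' (Nat.lt_succ_iff.mp (Finset.mem_range.mp hk))]
    · have h1 := hne m
      have h2 := hne n
      split_ifs with h0
      · subst h0
        simp only [Nat.sub_zero]
        field_simp
      · rw [mul_zero]
  rw [Finset.sum_congr rfl hdiag]
  simp
end

section
/- For all complex numbers s, t, z, z', the double series Σ_{m=0}^∞ Σ_{n=0}^∞ (s^m t^n / (m! n!)) L_{m,n}(z,z') converges absolutely and equals exp(sz + tz' - st). -/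
open Finset

theorem HasSum.mul_prod_of_complex {ι κ : Type*} {f : ι → ℂ} {g : κ → ℂ} {a b : ℂ}
    (hf : HasSum f a) (hg : HasSum g b) :
    HasSum (fun p : ι × κ => f p.1 * g p.2) (a * b) :=
  hf.mul hg (summable_mul_of_summable_norm hf.summable.norm hg.summable.norm)

theorem Complex.hasSum_pow_div_factorial (u : ℂ) :
    HasSum (fun n : ℕ => u ^ n / (Nat.factorial n : ℂ)) (Complex.exp u) := by
  rw [Complex.exp_eq_exp_ℂ]
  exact NormedSpace.expSeries_div_hasSum_exp u

/-- The product of three exponential series, as an absolutely convergent triple series. -/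
theorem hasSum_exp_triple (x y w : ℂ) :
    HasSum (fun q : (ℕ × ℕ) × ℕ =>
      x ^ q.1.1 / (Nat.factorial q.1.1 : ℂ) * (y ^ q.1.2 / (Nat.factorial q.1.2 : ℂ)) *
        (w ^ q.2 / (Nat.factorial q.2 : ℂ))) (Complex.exp (x + y + w)) := by
  rw [Complex.exp_add, Complex.exp_add]
  have hxy := (Complex.hasSum_pow_div_factorial x).mul_prod_of_complex
    (Complex.hasSum_pow_div_factorial y)
  have hxyw := hxy.mul_prod_of_complex (Complex.hasSum_pow_div_factorial w)
  exact hxyw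

/-- The `j`-th term of the generating series of `L2D` at the index `(m, n)`,
extended by zero to `j > min m n`. -/
noncomputable def L2DGenTerm (s t z z' : ℂ) (q : (ℕ × ℕ) × ℕ) : ℂ :=
  if q.2 ∈ Finset.range (min q.1.1 q.1.2 + 1) then
    (s * z) ^ (q.1.1 - q.2) / (Nat.factorial (q.1.1 - q.2) : ℂ) *
      ((t * z') ^ (q.1.2 - q.2) / (Nat.factorial (q.1.2 - q.2) : ℂ)) *
      ((-(s * t)) ^ q.2 / (Nat.factorial q.2 : ℂ))
  else 0

theorem hasSum_L2DGenTerm (s t z z' : ℂ) :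
    HasSum (L2DGenTerm s t z z') (Complex.exp (s * z + t * z' - s * t)) := by
  let i : (ℕ × ℕ) × ℕ → (ℕ × ℕ) × ℕ := fun q => ((q.1.1 + q.2, q.1.2 + q.2), q.2)
  have hi : Function.Injective i := by
    rintro ⟨⟨a, b⟩, j⟩ ⟨⟨a', b'⟩, j'⟩ h
    simp only [i, Prod.mk.injEq] at h ⊢
    omega
  have hsupp : ∀ q ∉ Set.range i, L2DGenTerm s t z z' q = 0 := by
    rintro ⟨⟨m, n⟩, j⟩ hq
    refine if_neg fun hj => hq ⟨((m - j, n - j), j), ?_⟩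
    simp only [Finset.mem_range] at hj
    simp only [i, Prod.mk.injEq, and_true]
    omega
  rw [← hi.hasSum_iff hsupp, sub_eq_add_neg]
  convert hasSum_exp_triple (s * z) (t * z') (-(s * t)) using 1
  funext q
  have hq : q.2 ∈ Finset.range (min (q.1.1 + q.2) (q.1.2 + q.2) + 1) := by
    rw [Finset.mem_range]
    omega
  simp only [Function.comp_apply, L2DGenTerm, i, if_pos hq, Nat.add_sub_cancel]

theorem sum_L2DGenTerm (s t z z' : ℂ) (m n : ℕ) :
    ∑ j ∈ Finset.range (min m n + 1), L2DGenTerm s t z z' ((m, n), j) =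
      s ^ m * t ^ n / ((Nat.factorial m : ℂ) * (Nat.factorial n : ℂ)) * L2D m n z z' := by
  rw [L2D, Finset.mul_sum]
  refine Finset.sum_congr rfl fun j hj => ?_
  rw [L2DGenTerm, if_pos hj]
  rw [Finset.mem_range] at hj
  obtain ⟨a, rfl⟩ : ∃ a, m = a + j := ⟨m - j, by omega⟩
  obtain ⟨b, rfl⟩ : ∃ b, n = b + j := ⟨n - j, by omega⟩
  have hf (k : ℕ) : (Nat.factorial k : ℂ) ≠ 0 := Nat.cast_ne_zero.2 k.factorial_ne_zero
  have ha := hf (a + j)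
  have hb := hf (b + j)
  simp only [Nat.add_sub_cancel]
  rw [neg_pow (s * t), mul_pow, mul_pow, mul_pow, pow_add, pow_add]
  field_simp

theorem L2D_generating_function (s t z z' : ℂ) :
    Summable (fun p : ℕ × ℕ =>
      ‖s ^ p.1 * t ^ p.2 / ((Nat.factorial p.1 : ℂ) * (Nat.factorial p.2 : ℂ)) *
        L2D p.1 p.2 z z'‖) ∧
    ∑' p : ℕ × ℕ,
      s ^ p.1 * t ^ p.2 / ((Nat.factorial p.1 : ℂ) * (Nat.factorial p.2 : ℂ)) *
        L2D p.1 p.2 z z' = Complex.exp (s * z + t * z' - s * t) := by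
  have hp (p : ℕ × ℕ) : HasSum (fun j => L2DGenTerm s t z z' (p, j))
      (s ^ p.1 * t ^ p.2 / ((Nat.factorial p.1 : ℂ) * (Nat.factorial p.2 : ℂ)) *
        L2D p.1 p.2 z z') := by
    rw [← sum_L2DGenTerm]
    exact hasSum_sum_of_ne_finset_zero fun j hj => if_neg hj
  have h := (hasSum_L2DGenTerm s t z z').prod_fiberwise hp
  exact ⟨h.summable.norm, h.tsum_eq⟩
end

section
/- For every nonnegative integer m and all complex numbers t, z, z', the series Σ_{n=0}^∞ (t^n / n!) L_{m,n}(z,z') converges absolutely and equals (z - t)^m · exp(t z'). -/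
open Finset

theorem hasSum_shifted_exp (w : ℂ) (j : ℕ) :
    HasSum (fun n : ℕ => if j ≤ n then w ^ (n - j) / (Nat.factorial (n - j) : ℂ) else 0)
      (Complex.exp w) := by
  rw [← (add_left_injective j).hasSum_iff]
  · rw [Complex.exp_eq_exp_ℂ]
    simpa [Function.comp_def] using NormedSpace.expSeries_div_hasSum_exp w
  · intro n hn
    refine if_neg fun h => hn ⟨n - j, Nat.sub_add_cancel h⟩

theorem pow_div_factorial_mul_L2D (m n : ℕ) (t z z' : ℂ) :
    t ^ n / (Nat.factorial n : ℂ) * L2D m n z z' =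
      ∑ j ∈ Finset.range (m + 1), (-t) ^ j * z ^ (m - j) * (m.choose j : ℂ) *
        (if j ≤ n then (t * z') ^ (n - j) / (Nat.factorial (n - j) : ℂ) else 0) := by
  have hsub : Finset.range (min m n + 1) ⊆ Finset.range (m + 1) :=
    Finset.range_subset_range.2 (by omega)
  rw [L2D, Finset.mul_sum, ← Finset.sum_subset hsub]
  · refine Finset.sum_congr rfl fun j hj => ?_
    have hjmn : j < min m n + 1 := Finset.mem_range.1 hj
    have hjm : j ≤ m := by omega
    have hjn : j ≤ n := by omega
    have hn : (Nat.factorial n : ℂ) ≠ 0 := Nat.cast_ne_zero.2 n.factorial_ne_zero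
    have ht : t ^ n = t ^ j * t ^ (n - j) := by rw [← pow_add, Nat.add_sub_cancel' hjn]
    rw [if_pos hjn, Nat.cast_choose ℂ hjm, ht, neg_pow t, mul_pow]
    field_simp
  · intro j hj hj'
    have hjn : ¬ j ≤ n := by
      simp only [Finset.mem_range] at hj hj'
      omega
    rw [if_neg hjn, mul_zero]

theorem hasSum_L2D_single_index (m : ℕ) (t z z' : ℂ) :
    HasSum (fun n : ℕ => t ^ n / (Nat.factorial n : ℂ) * L2D m n z z')
      ((z - t) ^ m * Complex.exp (t * z')) := by
  simp_rw [pow_div_factorial_mul_L2D]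
  rw [sub_eq_neg_add, add_pow, Finset.sum_mul]
  exact hasSum_sum fun j _ => (hasSum_shifted_exp (t * z') j).mul_left _

theorem L2D_single_index_generating_function (m : ℕ) (t z z' : ℂ) :
    Summable (fun n : ℕ => ‖t ^ n / (Nat.factorial n : ℂ) * L2D m n z z'‖) ∧
    ∑' n : ℕ, t ^ n / (Nat.factorial n : ℂ) * L2D m n z z' =
      (z - t) ^ m * Complex.exp (t * z') := by
  have h := hasSum_L2D_single_index m t z z'
  exact ⟨h.summable.norm, h.tsum_eq⟩
end

section
/- (Mehler's formula) For all real numbers x, y and every real number t with |t| < 1, the series Σ_{n=0}^∞ (t^n / (2^n n!)) H_n(x) H_n(y) converges absolutely and equals (1 - t²)^{-1/2} · exp((2 t x y - t² (x² + y²)) / (1 - t²)). -/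
open Finset

/-- The physicists' Hermite polynomials. -/
noncomputable def Hphys (n : ℕ) (x : ℝ) : ℝ :=
  ∑ l ∈ Finset.range (n / 2 + 1),
    (-1 : ℝ) ^ l * (Nat.factorial n : ℝ) /
      ((Nat.factorial l : ℝ) * (Nat.factorial (n - 2 * l) : ℝ)) * (2 * x) ^ (n - 2 * l)

open MeasureTheory

lemma integrable_pow_mul_exp_neg_sq (k : ℕ) :
    Integrable fun z : ℝ => z ^ k * Real.exp (-z ^ 2) := by
  simpa using integrable_rpow_mul_exp_neg_mul_sq one_pos
    (show (-1 : ℝ) < (k : ℝ) by linarith [k.cast_nonneg (α := ℝ)])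

lemma integral_mul_exp_neg_sq : ∫ z : ℝ, z * Real.exp (-z ^ 2) = 0 := by
  have hderiv (z : ℝ) :
      HasDerivAt (fun z : ℝ => -(1 / 2) * Real.exp (-z ^ 2)) (z * Real.exp (-z ^ 2)) z := by
    have h := (((hasDerivAt_pow 2 z).neg).exp).const_mul (-(1 / 2) : ℝ)
    refine HasDerivAt.congr_deriv h ?_
    simp
    ring
  have h0 := integrable_pow_mul_exp_neg_sq 0
  have h1 := integrable_pow_mul_exp_neg_sq 1
  simp only [pow_zero, one_mul, pow_one] at h0 h1
  exact integral_eq_zero_of_hasDerivAt_of_integrable hderiv h1 (h0.const_mul _)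

lemma integral_pow_add_two_mul_exp_neg_sq (k : ℕ) :
    ∫ z : ℝ, z ^ (k + 2) * Real.exp (-z ^ 2) =
      (k + 1) / 2 * ∫ z : ℝ, z ^ k * Real.exp (-z ^ 2) := by
  have hderiv (z : ℝ) : HasDerivAt (fun z : ℝ => z ^ (k + 1) * Real.exp (-z ^ 2))
      ((k + 1) * (z ^ k * Real.exp (-z ^ 2)) - 2 * (z ^ (k + 2) * Real.exp (-z ^ 2))) z := by
    have h := (hasDerivAt_pow (k + 1) z).mul ((hasDerivAt_pow 2 z).neg).exp
    refine HasDerivAt.congr_deriv h ?_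
    simp
    ring
  have hk := (integrable_pow_mul_exp_neg_sq k).const_mul ((k : ℝ) + 1)
  have hk2 := (integrable_pow_mul_exp_neg_sq (k + 2)).const_mul 2
  have h := integral_eq_zero_of_hasDerivAt_of_integrable hderiv (hk.sub hk2)
    (integrable_pow_mul_exp_neg_sq (k + 1))
  rw [integral_sub hk hk2, integral_const_mul, integral_const_mul] at h
  linarith

lemma integral_odd_pow_mul_exp_neg_sq (l : ℕ) :
    ∫ z : ℝ, z ^ (2 * l + 1) * Real.exp (-z ^ 2) = 0 := by
  induction l with
  | zero => simpa using integral_mul_exp_neg_sq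
  | succ l ih =>
    rw [show 2 * (l + 1) + 1 = 2 * l + 1 + 2 by ring, integral_pow_add_two_mul_exp_neg_sq, ih,
      mul_zero]

lemma integral_even_pow_mul_exp_neg_sq (l : ℕ) :
    ∫ z : ℝ, z ^ (2 * l) * Real.exp (-z ^ 2) =
      (Nat.factorial (2 * l) : ℝ) / (4 ^ l * (Nat.factorial l : ℝ)) * √Real.pi := by
  induction l with
  | zero => simpa using integral_gaussian 1
  | succ l ih =>
    rw [show 2 * (l + 1) = 2 * l + 2 by ring, integral_pow_add_two_mul_exp_neg_sq, ih,
      Nat.factorial_succ, Nat.factorial_succ (2 * l), Nat.factorial_succ l]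
    have := Nat.factorial_ne_zero l
    push_cast
    field_simp
    ring

/-- A sum whose odd-indexed terms vanish is the sum of its even-indexed terms. -/
lemma sum_range_eq_sum_even {M : Type*} [AddCommMonoid M] (f : ℕ → M)
    (hf : ∀ l, f (2 * l + 1) = 0) (n : ℕ) :
    ∑ k ∈ range (n + 1), f k = ∑ l ∈ range (n / 2 + 1), f (2 * l) := by
  symm
  refine Finset.sum_of_injOn (fun l => 2 * l) (fun a _ b _ h => by simpa using h)
    (fun l hl => ?_) (fun k hk hk' => ?_) (fun _ _ => rfl)
  · simp only [coe_range, Set.mem_Iio] at hl ⊢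
    omega
  · obtain ⟨l, rfl | rfl⟩ := k.even_or_odd'
    · refine absurd ⟨l, ?_, rfl⟩ hk'
      simp only [coe_range, Set.mem_Iio, mem_range] at hk ⊢
      omega
    · exact hf l

/-- The integral representation of the Hermite polynomials. -/
lemma integral_pow_mul_exp_neg_sq_eq_Hphys (n : ℕ) (x : ℝ) :
    ∫ z : ℝ, (2 * (x + Complex.I * z)) ^ n * ((Real.exp (-z ^ 2) : ℝ) : ℂ) =
      ((√Real.pi * Hphys n x : ℝ) : ℂ) := by
  have hexpand (z : ℝ) : (2 * (x + Complex.I * z)) ^ n * ((Real.exp (-z ^ 2) : ℝ) : ℂ) =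
      ∑ k ∈ range (n + 1), (2 ^ n * Complex.I ^ k * (x : ℂ) ^ (n - k) * (n.choose k : ℂ)) *
        ((z ^ k * Real.exp (-z ^ 2) : ℝ) : ℂ) := by
    rw [mul_pow, add_comm (x : ℂ), add_pow, Finset.mul_sum, Finset.sum_mul]
    refine Finset.sum_congr rfl fun k _ => ?_
    push_cast
    ring
  simp_rw [hexpand]
  rw [integral_finsetSum _ fun k _ => (integrable_pow_mul_exp_neg_sq k).ofReal.const_mul _]
  simp_rw [integral_const_mul, integral_complex_ofReal]
  rw [sum_range_eq_sum_even _ fun l => by simp [integral_odd_pow_mul_exp_neg_sq], Hphys,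
    Finset.mul_sum, Complex.ofReal_sum]
  refine Finset.sum_congr rfl fun l hl => ?_
  obtain ⟨m, rfl⟩ : ∃ m, n = 2 * l + m :=
    Nat.exists_eq_add_of_le (by rw [mem_range] at hl; omega)
  rw [integral_even_pow_mul_exp_neg_sq, Nat.cast_choose ℂ (by omega), pow_mul, Complex.I_sq,
    Nat.add_sub_cancel_left]
  have h4 : (4 : ℂ) ^ l = 2 ^ (2 * l) := by rw [pow_mul]; norm_num
  have := Nat.factorial_ne_zero l
  have := Nat.factorial_ne_zero m
  have := Nat.factorial_ne_zero (2 * l)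
  push_cast
  rw [h4]
  field_simp
  ring

lemma integrable_exp_mul_neg_sq_prod {c : ℝ} (hc : 0 < c) :
    Integrable fun p : ℝ × ℝ => Real.exp (-c * p.1 ^ 2) * Real.exp (-c * p.2 ^ 2) :=
  (integrable_exp_neg_mul_sq hc).mul_prod (integrable_exp_neg_mul_sq hc)

lemma norm_mul_le_half_sq_add (x y z w : ℝ) :
    ‖((x : ℂ) + Complex.I * z) * (y + Complex.I * w)‖ ≤
      (x ^ 2 + z ^ 2 + (y ^ 2 + w ^ 2)) / 2 := by
  have hsq (a b : ℝ) : ‖(a : ℂ) + Complex.I * b‖ ^ 2 = a ^ 2 + b ^ 2 := by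
    rw [mul_comm, ← Complex.normSq_eq_norm_sq, Complex.normSq_add_mul_I]
  rw [norm_mul, ← hsq, ← hsq]
  linarith [two_mul_le_add_sq ‖(x : ℂ) + Complex.I * z‖ ‖(y : ℂ) + Complex.I * w‖]

lemma integrable_exp_norm_mul_exp_neg_sq {x y t : ℝ} (ht : |t| < 1) :
    Integrable fun p : ℝ × ℝ =>
      Real.exp ‖2 * t * (((x : ℂ) + Complex.I * p.1) * (y + Complex.I * p.2))‖ *
        (Real.exp (-p.1 ^ 2) * Real.exp (-p.2 ^ 2)) := by
  refine ((integrable_exp_mul_neg_sq_prod (sub_pos.2 ht)).const_mul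
    (Real.exp (|t| * (x ^ 2 + y ^ 2)))).mono' (by fun_prop) (.of_forall fun p => ?_)
  rw [Real.norm_of_nonneg (by positivity)]
  simp only [← Real.exp_add]
  rw [Real.exp_le_exp, norm_mul, norm_mul, Complex.norm_real, Real.norm_eq_abs,
    Complex.norm_ofNat]
  nlinarith [mul_le_mul_of_nonneg_left (norm_mul_le_half_sq_add x y p.1 p.2) (abs_nonneg t)]

lemma integral_cexp_mul_exp_neg_sq (a : ℂ) :
    ∫ w : ℝ, Complex.exp (a * w) * ((Real.exp (-w ^ 2) : ℝ) : ℂ) =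
      √Real.pi * Complex.exp (a ^ 2 / 4) := by
  have h := integral_cexp_quadratic (b := -1) (by simp) a 0
  convert h using 2
  · ext w
    push_cast
    rw [← Complex.exp_add]
    ring_nf
  · rw [Real.sqrt_eq_rpow, Complex.ofReal_cpow Real.pi_pos.le]
    simp
  · ring_nf

lemma integral_mehler_kernel {x y t : ℝ} (ht : |t| < 1) :
    ∫ p : ℝ × ℝ, Complex.exp (2 * t * (((x : ℂ) + Complex.I * p.1) * (y + Complex.I * p.2))) *
        (((Real.exp (-p.1 ^ 2) : ℝ) : ℂ) * ((Real.exp (-p.2 ^ 2) : ℝ) : ℂ)) =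
      ((Real.pi * ((1 / √(1 - t ^ 2)) *
        Real.exp ((2 * t * x * y - t ^ 2 * (x ^ 2 + y ^ 2)) / (1 - t ^ 2))) : ℝ) : ℂ) := by
  have hpos : 0 < 1 - t ^ 2 := sub_pos.2 ((sq_lt_one_iff_abs_lt_one t).2 ht)
  have hint : Integrable fun p : ℝ × ℝ =>
      Complex.exp (2 * t * (((x : ℂ) + Complex.I * p.1) * (y + Complex.I * p.2))) *
        (((Real.exp (-p.1 ^ 2) : ℝ) : ℂ) * ((Real.exp (-p.2 ^ 2) : ℝ) : ℂ)) := by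
    refine (integrable_exp_norm_mul_exp_neg_sq (x := x) (y := y) ht).mono' (by fun_prop)
      (.of_forall fun p => ?_)
    rw [norm_mul, norm_mul, Complex.norm_real, Complex.norm_real,
      Real.norm_of_nonneg (by positivity), Real.norm_of_nonneg (by positivity), Complex.norm_exp]
    gcongr
    exact Complex.re_le_norm _
  rw [Measure.volume_eq_prod] at hint ⊢
  rw [integral_prod _ hint]
  have hinner (z : ℝ) :
      ∫ w : ℝ, Complex.exp (2 * t * (((x : ℂ) + Complex.I * z) * (y + Complex.I * w))) *
        (((Real.exp (-z ^ 2) : ℝ) : ℂ) * ((Real.exp (-w ^ 2) : ℝ) : ℂ)) =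
      √Real.pi * Complex.exp (-(1 - t ^ 2 : ℝ) * z ^ 2 +
        (2 * Complex.I * t * (y - t * x)) * z + (2 * t * x * y - t ^ 2 * x ^ 2)) := by
    have h (w : ℝ) :
        Complex.exp (2 * t * (((x : ℂ) + Complex.I * z) * (y + Complex.I * w))) *
          (((Real.exp (-z ^ 2) : ℝ) : ℂ) * ((Real.exp (-w ^ 2) : ℝ) : ℂ)) =
        Complex.exp (2 * t * (x + Complex.I * z) * y - z ^ 2) *
          (Complex.exp ((2 * t * Complex.I * (x + Complex.I * z)) * w) *
            ((Real.exp (-w ^ 2) : ℝ) : ℂ)) := by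
      push_cast
      simp only [← Complex.exp_add]
      ring_nf
    simp_rw [h]
    rw [integral_const_mul, integral_cexp_mul_exp_neg_sq, mul_left_comm, ← Complex.exp_add]
    congr 2
    push_cast
    ring_nf
    simp only [Complex.I_sq, show Complex.I ^ 4 = 1 from Complex.I_pow_four,
      show Complex.I ^ 3 = -Complex.I from Complex.I_pow_three]
    ring
  simp_rw [hinner]
  rw [integral_const_mul, integral_cexp_quadratic (by rwa [Complex.neg_re, Complex.ofReal_re, neg_lt_zero])]
  have hne : (1 - (t : ℂ) ^ 2) ≠ 0 := by exact_mod_cast hpos.ne'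
  have hsqrt : ((Real.pi : ℂ) / -(-((1 - t ^ 2 : ℝ) : ℂ))) ^ (1 / 2 : ℂ) =
      ((√Real.pi / √(1 - t ^ 2) : ℝ) : ℂ) := by
    rw [← Real.sqrt_div Real.pi_pos.le, Real.sqrt_eq_rpow, Complex.ofReal_cpow (by positivity)]
    simp
  rw [hsqrt, ← mul_assoc, ← Complex.ofReal_mul, ← mul_assoc, Complex.ofReal_mul _ (Real.exp _),
    Complex.ofReal_exp]
  congr 2
  · rw [← mul_div_assoc, Real.mul_self_sqrt Real.pi_pos.le, mul_one_div]
  · push_cast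
    field_simp
    ring_nf
    simp only [Complex.I_sq]
    ring

lemma integral_mehler_term (x y t : ℝ) (n : ℕ) :
    ∫ p : ℝ × ℝ, (2 * t * (((x : ℂ) + Complex.I * p.1) * (y + Complex.I * p.2))) ^ n /
        (Nat.factorial n : ℂ) *
        (((Real.exp (-p.1 ^ 2) : ℝ) : ℂ) * ((Real.exp (-p.2 ^ 2) : ℝ) : ℂ)) =
      ((Real.pi * (t ^ n / (2 ^ n * (Nat.factorial n : ℝ)) * Hphys n x * Hphys n y) : ℝ) : ℂ) := by
  have h (p : ℝ × ℝ) :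
      (2 * t * (((x : ℂ) + Complex.I * p.1) * (y + Complex.I * p.2))) ^ n /
        (Nat.factorial n : ℂ) *
        (((Real.exp (-p.1 ^ 2) : ℝ) : ℂ) * ((Real.exp (-p.2 ^ 2) : ℝ) : ℂ)) =
      ((t : ℂ) ^ n / (2 ^ n * (Nat.factorial n : ℂ))) *
        (((2 * (x + Complex.I * p.1)) ^ n * ((Real.exp (-p.1 ^ 2) : ℝ) : ℂ)) *
          ((2 * (y + Complex.I * p.2)) ^ n * ((Real.exp (-p.2 ^ 2) : ℝ) : ℂ))) := by
    simp only [mul_pow]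
    field_simp
  simp_rw [h]
  rw [integral_const_mul, Measure.volume_eq_prod,
    integral_prod_mul (fun z : ℝ => (2 * (x + Complex.I * z)) ^ n * ((Real.exp (-z ^ 2) : ℝ) : ℂ))
      (fun w : ℝ => (2 * (y + Complex.I * w)) ^ n * ((Real.exp (-w ^ 2) : ℝ) : ℂ)),
    integral_pow_mul_exp_neg_sq_eq_Hphys, integral_pow_mul_exp_neg_sq_eq_Hphys,
    ← Complex.ofReal_mul]
  rw [show √Real.pi * Hphys n x * (√Real.pi * Hphys n y) = Real.pi * (Hphys n x * Hphys n y) by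
    rw [mul_mul_mul_comm, Real.mul_self_sqrt Real.pi_pos.le]]
  push_cast
  ring

lemma hasSum_mehler {x y t : ℝ} (ht : |t| < 1) :
    HasSum (fun n : ℕ => t ^ n / (2 ^ n * (Nat.factorial n : ℝ)) * Hphys n x * Hphys n y)
      ((1 / √(1 - t ^ 2)) *
        Real.exp ((2 * t * x * y - t ^ 2 * (x ^ 2 + y ^ 2)) / (1 - t ^ 2))) := by
  let u (p : ℝ × ℝ) : ℂ := 2 * t * (((x : ℂ) + Complex.I * p.1) * (y + Complex.I * p.2))
  have hbound (p : ℝ × ℝ) :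
      HasSum (fun n : ℕ => ‖u p‖ ^ n / (Nat.factorial n : ℝ) *
          (Real.exp (-p.1 ^ 2) * Real.exp (-p.2 ^ 2)))
        (Real.exp ‖u p‖ * (Real.exp (-p.1 ^ 2) * Real.exp (-p.2 ^ 2))) := by
    rw [Real.exp_eq_exp_ℝ]
    exact (NormedSpace.expSeries_div_hasSum_exp ‖u p‖).mul_right _
  have h := hasSum_integral_of_dominated_convergence (μ := (volume : Measure (ℝ × ℝ)))
    (F := fun (n : ℕ) (p : ℝ × ℝ) => u p ^ n / (Nat.factorial n : ℂ) *
      (((Real.exp (-p.1 ^ 2) : ℝ) : ℂ) * ((Real.exp (-p.2 ^ 2) : ℝ) : ℂ)))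
    (f := fun p => Complex.exp (u p) *
      (((Real.exp (-p.1 ^ 2) : ℝ) : ℂ) * ((Real.exp (-p.2 ^ 2) : ℝ) : ℂ)))
    (fun n p => ‖u p‖ ^ n / (Nat.factorial n : ℝ) *
      (Real.exp (-p.1 ^ 2) * Real.exp (-p.2 ^ 2)))
    (fun n => by fun_prop)
    (fun n => .of_forall fun p => by simp [-Complex.ofReal_exp])
    (.of_forall fun p => (hbound p).summable)
    (by
      simp_rw [fun p => (hbound p).tsum_eq]
      exact integrable_exp_norm_mul_exp_neg_sq ht)
    (.of_forall fun p => by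
      rw [Complex.exp_eq_exp_ℂ]
      exact (NormedSpace.expSeries_div_hasSum_exp (u p)).mul_right _)
  rw [integral_mehler_kernel ht] at h
  simp_rw [u, integral_mehler_term] at h
  rw [Complex.hasSum_ofReal] at h
  exact (hasSum_mul_left_iff Real.pi_ne_zero).1 h

theorem mehler_formula (x y t : ℝ) (ht : |t| < 1) :
    Summable (fun n : ℕ =>
      |t ^ n / (2 ^ n * (Nat.factorial n : ℝ)) * Hphys n x * Hphys n y|) ∧
    ∑' n : ℕ, t ^ n / (2 ^ n * (Nat.factorial n : ℝ)) * Hphys n x * Hphys n y =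
      (1 / Real.sqrt (1 - t ^ 2)) *
        Real.exp ((2 * t * x * y - t ^ 2 * (x ^ 2 + y ^ 2)) / (1 - t ^ 2)) := by
  exact ⟨(hasSum_mehler ht).summable.abs, (hasSum_mehler ht).tsum_eq⟩
end

section
/- For every nonnegative integer n and all real numbers x, y, the product of Hermite polynomials satisfies H_n(x) H_n(y) = 2^{-n} Σ_{k=0}^{n} (-1)^k (n! / (k! (n-k)!)) · H_{2(n-k)}((x+y)/√2) · H_{2k}((x-y)/√2). -/
open Finset

lemma Hphys_eq_sum_descFactorial (n N : ℕ) (hN : n / 2 < N) (x : ℝ) :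
    Hphys n x = ∑ l ∈ Finset.range N,
      (-1 : ℝ) ^ l * (n.descFactorial (2 * l) : ℝ) / (l.factorial : ℝ) *
        (2 * x) ^ (n - 2 * l) := by
  unfold Hphys
  rw [← Finset.sum_subset (Finset.range_subset_range.2 (Nat.succ_le_of_lt hN))]
  · refine Finset.sum_congr rfl fun l hl => ?_
    have h2 : 2 * l ≤ n := by have := Finset.mem_range.1 hl; omega
    have hf : (n.factorial : ℝ) = ((n - 2 * l).factorial : ℝ) * n.descFactorial (2 * l) := by
      exact_mod_cast (Nat.factorial_mul_descFactorial h2).symm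
    have h3 : ((n - 2 * l).factorial : ℝ) ≠ 0 := by positivity
    rw [hf]
    field_simp
  · intro l _ hl
    have h2 : n < 2 * l := by simp only [Finset.mem_range] at hl; omega
    simp [Nat.descFactorial_of_lt h2]

lemma Hphys_zero (x : ℝ) : Hphys 0 x = 1 := by simp [Hphys]

lemma Hphys_one (x : ℝ) : Hphys 1 x = 2 * x := by simp [Hphys]

lemma descFactorial_succ_succ_eq_add (n m : ℕ) :
    (n + 1).descFactorial (m + 1) = n.descFactorial (m + 1) + (m + 1) * n.descFactorial m := by
  rw [Nat.succ_descFactorial_succ, Nat.descFactorial_succ]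
  rcases le_or_gt m n with h | h
  · rw [← add_mul]
    congr 1
    omega
  · simp [Nat.descFactorial_of_lt h]

lemma Hphys_add_two (n : ℕ) (x : ℝ) :
    Hphys (n + 2) x = 2 * x * Hphys (n + 1) x - 2 * (n + 1) * Hphys n x := by
  rw [Hphys_eq_sum_descFactorial (n + 2) (n + 3) (by omega),
    Hphys_eq_sum_descFactorial (n + 1) (n + 3) (by omega),
    Hphys_eq_sum_descFactorial n (n + 2) (by omega),
    Finset.sum_range_succ' _ (n + 2), Finset.sum_range_succ' _ (n + 2), mul_add, Finset.mul_sum,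
    Finset.mul_sum, add_sub_right_comm, ← Finset.sum_sub_distrib]
  congr 1
  · refine Finset.sum_congr rfl fun l _ => ?_
    have hD : ((n + 2).descFactorial (2 * (l + 1)) : ℝ) =
        (n + 1).descFactorial (2 * (l + 1)) +
          2 * (l + 1) * ((n + 1) * n.descFactorial (2 * l)) := by
      have h := descFactorial_succ_succ_eq_add (n + 1) (2 * l + 1)
      rw [Nat.succ_descFactorial_succ n (2 * l)] at h
      have h' := congrArg (Nat.cast : ℕ → ℝ) h
      push_cast at h'
      rw [show 2 * (l + 1) = 2 * l + 1 + 1 by ring, h']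
      ring
    have hP : ((n + 1).descFactorial (2 * (l + 1)) : ℝ) * (2 * x) ^ (n - 2 * l) =
        (n + 1).descFactorial (2 * (l + 1)) * (2 * x * (2 * x) ^ (n + 1 - 2 * (l + 1))) := by
      rcases le_or_gt (2 * (l + 1)) (n + 1) with h | h
      · rw [← pow_succ', show n + 1 - 2 * (l + 1) + 1 = n - 2 * l by omega]
      · simp [Nat.descFactorial_of_lt h]
    rw [show n + 2 - 2 * (l + 1) = n - 2 * l by omega, hD, Nat.factorial_succ]
    push_cast
    have hl : (l.factorial : ℝ) ≠ 0 := by positivity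
    have hl' : (l + 1 : ℝ) ≠ 0 := by positivity
    field_simp
    linear_combination (-1) ^ (l + 1) * hP
  · simp [pow_succ]
    ring

lemma Hphys_succ (n : ℕ) (x : ℝ) :
    Hphys (n + 1) x = 2 * x * Hphys n x - 2 * n * Hphys (n - 1) x := by
  cases n with
  | zero => simp [Hphys_zero, Hphys_one]
  | succ n => simp [Hphys_add_two]

open MvPolynomial in
/-- The linear functional on bivariate polynomials sending `X ^ a * Y ^ b` to
`H_a(x) * H_b(y)`. -/
noncomputable def hermiteFunctional (x y : ℝ) : MvPolynomial (Fin 2) ℝ →ₗ[ℝ] ℝ :=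
  (basisMonomials (Fin 2) ℝ).constr ℝ fun s => Hphys (s 0) x * Hphys (s 1) y

section hermiteFunctional

open MvPolynomial

variable (x y : ℝ)

lemma hermiteFunctional_monomial (s : Fin 2 →₀ ℕ) (c : ℝ) :
    hermiteFunctional x y (monomial s c) = c * (Hphys (s 0) x * Hphys (s 1) y) := by
  have h : monomial s c = c • basisMonomials (Fin 2) ℝ s := by
    simp [coe_basisMonomials, smul_monomial]
  rw [h, map_smul, hermiteFunctional, Module.Basis.constr_basis, smul_eq_mul]

lemma hermiteFunctional_one : hermiteFunctional x y 1 = 1 := by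
  simpa [Hphys_zero] using hermiteFunctional_monomial x y 0 1

lemma hermiteFunctional_X_pow_mul_X_pow (a b : ℕ) :
    hermiteFunctional x y (X 0 ^ a * X 1 ^ b) = Hphys a x * Hphys b y := by
  rw [X_pow_eq_monomial, X_pow_eq_monomial, monomial_mul, hermiteFunctional_monomial]
  simp

lemma hermiteFunctional_X_zero_mul (p : MvPolynomial (Fin 2) ℝ) :
    hermiteFunctional x y (X 0 * p) =
      2 * x * hermiteFunctional x y p - 2 * hermiteFunctional x y (pderiv 0 p) := by
  induction p using MvPolynomial.induction_on' with
  | add p q hp hq => simp only [mul_add, map_add, hp, hq]; ring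
  | monomial s c =>
    rw [X, monomial_mul, pderiv_monomial]
    simp only [hermiteFunctional_monomial]
    simp [add_comm 1 (s 0), Hphys_succ]
    ring

lemma hermiteFunctional_X_one_mul (p : MvPolynomial (Fin 2) ℝ) :
    hermiteFunctional x y (X 1 * p) =
      2 * y * hermiteFunctional x y p - 2 * hermiteFunctional x y (pderiv 1 p) := by
  induction p using MvPolynomial.induction_on' with
  | add p q hp hq => simp only [mul_add, map_add, hp, hq]; ring
  | monomial s c =>
    rw [X, monomial_mul, pderiv_monomial]
    simp only [hermiteFunctional_monomial]
    simp [add_comm 1 (s 1), Hphys_succ]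
    ring

lemma hermiteFunctional_linear_mul (α β : ℝ) (p : MvPolynomial (Fin 2) ℝ) :
    hermiteFunctional x y ((α • X 0 + β • X 1) * p) =
      2 * (α * x + β * y) * hermiteFunctional x y p -
        2 * hermiteFunctional x y ((α • pderiv 0 + β • pderiv 1 :
          Derivation ℝ (MvPolynomial (Fin 2) ℝ) (MvPolynomial (Fin 2) ℝ)) p) := by
  simp only [add_mul, smul_mul_assoc, map_add, map_smul, hermiteFunctional_X_zero_mul,
    hermiteFunctional_X_one_mul, smul_eq_mul, Derivation.add_apply, Derivation.smul_apply]
  ring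

/-- Multiplication by a linear form with unit coefficient vector, applied to powers of that form
and powers of an orthogonal form, follows the Hermite recurrence. -/
lemma hermiteFunctional_linear_pow_succ_mul {α β γ δ : ℝ} (h1 : α * α + β * β = 1)
    (h0 : α * γ + β * δ = 0) (a b : ℕ) :
    hermiteFunctional x y ((α • X 0 + β • X 1) ^ (a + 1) * (γ • X 0 + δ • X 1) ^ b) =
      2 * (α * x + β * y) *
          hermiteFunctional x y ((α • X 0 + β • X 1) ^ a * (γ • X 0 + δ • X 1) ^ b) -
        2 * a *
          hermiteFunctional x y ((α • X 0 + β • X 1) ^ (a - 1) * (γ • X 0 + δ • X 1) ^ b) := by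
  have hD : ∀ μ ν : ℝ, (α • pderiv 0 + β • pderiv 1 :
      Derivation ℝ (MvPolynomial (Fin 2) ℝ) (MvPolynomial (Fin 2) ℝ)) (μ • X 0 + ν • X 1) =
        C (α * μ + β * ν) := by
    intro μ ν
    simp [pderiv_X, smul_eq_C_mul]
  rw [pow_succ', mul_assoc, hermiteFunctional_linear_mul, Derivation.leibniz,
    Derivation.leibniz_pow, Derivation.leibniz_pow, hD, hD, h1, h0]
  simp only [map_zero, map_one, mul_zero, smul_zero, zero_add, smul_eq_mul, mul_one]
  rw [← Nat.cast_smul_eq_nsmul ℝ, mul_smul_comm, map_smul, smul_eq_mul, mul_comm (_ ^ b)]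
  ring

lemma hermiteFunctional_linear_pow_mul {α β γ δ : ℝ} (h1 : α * α + β * β = 1)
    (h0 : α * γ + β * δ = 0) (a b : ℕ) :
    hermiteFunctional x y ((α • X 0 + β • X 1) ^ a * (γ • X 0 + δ • X 1) ^ b) =
      Hphys a (α * x + β * y) * hermiteFunctional x y ((γ • X 0 + δ • X 1) ^ b) := by
  induction a using Nat.strong_induction_on with
  | _ a ih =>
    cases a with
    | zero => simp [Hphys_zero]
    | succ a =>
      rw [hermiteFunctional_linear_pow_succ_mul x y h1 h0, Hphys_succ, ih a (by omega),
        ih (a - 1) (by omega)]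
      ring

/-- Rotation invariance of the Hermite functional. -/
lemma hermiteFunctional_orthogonal {α β γ δ : ℝ} (h1 : α * α + β * β = 1)
    (h2 : γ * γ + δ * δ = 1) (h0 : α * γ + β * δ = 0) (a b : ℕ) :
    hermiteFunctional x y ((α • X 0 + β • X 1) ^ a * (γ • X 0 + δ • X 1) ^ b) =
      Hphys a (α * x + β * y) * Hphys b (γ * x + δ * y) := by
  have h := hermiteFunctional_linear_pow_mul x y (α := γ) (β := δ) (γ := α) (δ := β) h2
    (by linarith) b 0
  rw [pow_zero, mul_one, hermiteFunctional_one, mul_one] at h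
  rw [hermiteFunctional_linear_pow_mul x y h1 h0, h]

end hermiteFunctional

open MvPolynomial in
theorem hermite_product_factorization (n : ℕ) (x y : ℝ) :
    Hphys n x * Hphys n y =
      (1 / 2 ^ n) * ∑ k ∈ Finset.range (n + 1),
        (-1 : ℝ) ^ k * ((Nat.factorial n : ℝ) /
          ((Nat.factorial k : ℝ) * (Nat.factorial (n - k) : ℝ))) *
          Hphys (2 * (n - k)) ((x + y) / Real.sqrt 2) *
          Hphys (2 * k) ((x - y) / Real.sqrt 2) := by
  obtain ⟨r, hr⟩ : ∃ r, r = (Real.sqrt 2)⁻¹ := ⟨_, rfl⟩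
  have hr2 : r * r = 1 / 2 := by
    rw [hr, ← mul_inv, Real.mul_self_sqrt (by norm_num)]
    norm_num
  have hXY : (X 0 * X 1 : MvPolynomial (Fin 2) ℝ) =
      (1 / 2 : ℝ) • (-(r • X 0 + (-r) • X 1) ^ 2 + (r • X 0 + r • X 1) ^ 2) := by
    have hC : (C r * C r : MvPolynomial (Fin 2) ℝ) = C (1 / 2) := by rw [← C_mul, hr2]
    have hC2 : (C (1 / 2) * 2 : MvPolynomial (Fin 2) ℝ) = 1 := by
      rw [show (2 : MvPolynomial (Fin 2) ℝ) = C 2 from (map_ofNat C 2).symm, ← C_mul]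
      norm_num
    simp only [smul_eq_C_mul, map_neg]
    linear_combination (-(4 : MvPolynomial (Fin 2) ℝ) * C (1 / 2) * X 0 * X 1) * hC -
      (1 + C (1 / 2) * 2) * X 0 * X 1 * hC2
  rw [← hermiteFunctional_X_pow_mul_X_pow, ← mul_pow, hXY, smul_pow, map_smul, add_pow, map_sum,
    smul_eq_mul, one_div_pow]
  congr 1
  refine Finset.sum_congr rfl fun k hk => ?_
  have hkn : k ≤ n := Nat.lt_succ_iff.1 (Finset.mem_range.1 hk)
  have hterm : (-(r • X 0 + (-r) • X 1) ^ 2) ^ k * ((r • X 0 + r • X 1) ^ 2) ^ (n - k) *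
      (n.choose k : MvPolynomial (Fin 2) ℝ) =
      ((-1) ^ k * (n.choose k : ℝ)) •
        ((r • X 0 + r • X 1) ^ (2 * (n - k)) * (r • X 0 + (-r) • X 1) ^ (2 * k)) := by
    rw [neg_pow, ← pow_mul, ← pow_mul, smul_eq_C_mul (_ * _) ((-1) ^ k * (n.choose k : ℝ))]
    simp only [map_mul, map_pow, map_neg, map_one, map_natCast]
    ring
  rw [hterm, map_smul, hermiteFunctional_orthogonal x y (by linarith) (by linarith) (by ring),
    Nat.cast_choose ℝ hkn, smul_eq_mul, div_eq_mul_inv (x + y), div_eq_mul_inv (x - y), ← hr,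
    show r * x + r * y = (x + y) * r by ring, show r * x + -r * y = (x - y) * r by ring]
  ring
end

section
/- For every real number x and every real number t with |t| < 1, the series Σ_{m=0}^∞ ((-1)^m / m!) (t/2)^{2m} H_{2m}(x) converges absolutely and equals (1 - t²)^{-1/2} · exp(-(t x)² / (1 - t²)). -/
open Finset

lemma Ring.succ_mul_multichoose_succ (r : ℝ) (l : ℕ) :
    (l + 1 : ℝ) * Ring.multichoose r (l + 1) = (r + l) * Ring.multichoose r l := by
  have h₁ := Ring.factorial_nsmul_multichoose_eq_ascPochhammer r (l + 1)
  have h₀ := Ring.factorial_nsmul_multichoose_eq_ascPochhammer r l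
  rw [ascPochhammer_succ_right, Polynomial.smeval_mul, ← h₀, Nat.factorial_succ] at h₁
  simp only [nsmul_eq_mul, Polynomial.smeval_add, Polynomial.smeval_X, pow_one,
    Polynomial.smeval_natCast, pow_zero, mul_one] at h₁
  push_cast at h₁
  have hl : (l.factorial : ℝ) ≠ 0 := by positivity
  apply mul_left_cancel₀ hl
  linarith

lemma Ring.multichoose_add_half (k l : ℕ) :
    Ring.multichoose ((k : ℝ) + 1 / 2) l =
      ((2 * (k + l)).factorial * k.factorial : ℝ) /
        (l.factorial * (k + l).factorial * 4 ^ l * (2 * k).factorial) := by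
  induction l with
  | zero =>
    rw [Ring.multichoose_zero_right]
    simp only [add_zero, Nat.factorial_zero, Nat.cast_one, pow_zero, mul_one, one_mul]
    field_simp
  | succ l ih =>
    have h := Ring.succ_mul_multichoose_succ ((k : ℝ) + 1 / 2) l
    have hl : (l + 1 : ℝ) ≠ 0 := by positivity
    rw [ih] at h
    apply mul_left_cancel₀ hl
    rw [h, show 2 * (k + (l + 1)) = 2 * (k + l) + 1 + 1 by ring,
      show k + (l + 1) = k + l + 1 by ring]
    simp only [Nat.factorial_succ]
    push_cast
    field_simp
    ring

lemma Ring.hasSum_multichoose_mul_pow (r : ℝ) {s : ℝ} (hs : |s| < 1) :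
    HasSum (fun l : ℕ => Ring.multichoose r l * s ^ l) (1 / (1 - s) ^ r) := by
  have h := (Real.one_div_one_sub_rpow_hasFPowerSeriesOnBall_zero r).hasSum (y := s)
    (by simpa [enorm_eq_nnnorm, ← NNReal.coe_lt_coe] using hs)
  simpa [FormalMultilinearSeries.ofScalars_apply_eq, Ring.multichoose_eq, mul_comm] using h

lemma hasSum_pow_div_factorial_mul_multichoose {s : ℝ} (hs : |s| < 1) (y : ℝ) (k : ℕ) :
    HasSum (fun l : ℕ => y ^ k / k.factorial * (Ring.multichoose ((k : ℝ) + 1 / 2) l * s ^ l))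
      (1 / √(1 - s) * ((y / (1 - s)) ^ k / k.factorial)) := by
  have hs' : 0 < 1 - s := by linarith [(abs_lt.mp hs).2]
  have hsum : 1 / √(1 - s) * ((y / (1 - s)) ^ k / k.factorial) =
      y ^ k / k.factorial * (1 / (1 - s) ^ ((k : ℝ) + 1 / 2)) := by
    rw [Real.rpow_add hs', Real.rpow_natCast, ← Real.sqrt_eq_rpow, div_pow]
    have := Real.sqrt_pos.mpr hs'
    field_simp
  rw [hsum]
  exact (Ring.hasSum_multichoose_mul_pow ((k : ℝ) + 1 / 2) hs).mul_left (y ^ k / k.factorial)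

lemma hasSum_exp_div (y s : ℝ) :
    HasSum (fun k : ℕ => 1 / √(1 - s) * ((y / (1 - s)) ^ k / k.factorial))
      (1 / √(1 - s) * Real.exp (y / (1 - s))) := by
  rw [Real.exp_eq_exp_ℝ]
  exact (NormedSpace.expSeries_div_hasSum_exp (y / (1 - s))).mul_left _

lemma summable_pow_div_factorial_mul_multichoose {s : ℝ} (hs₀ : 0 ≤ s) (hs : s < 1) (y : ℝ) :
    Summable (fun p : ℕ × ℕ => y ^ p.1 / p.1.factorial *
      (Ring.multichoose ((p.1 : ℝ) + 1 / 2) p.2 * s ^ p.2)) := by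
  have hs' : |s| < 1 := by rwa [abs_of_nonneg hs₀]
  have hM (k l : ℕ) : 0 ≤ Ring.multichoose ((k : ℝ) + 1 / 2) l := by
    rw [Ring.multichoose_add_half]; positivity
  rw [← summable_abs_iff]
  have habs (p : ℕ × ℕ) : |y ^ p.1 / p.1.factorial *
      (Ring.multichoose ((p.1 : ℝ) + 1 / 2) p.2 * s ^ p.2)| =
      |y| ^ p.1 / p.1.factorial * (Ring.multichoose ((p.1 : ℝ) + 1 / 2) p.2 * s ^ p.2) := by
    rw [abs_mul, abs_div, abs_pow, Nat.abs_cast,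
      abs_of_nonneg (mul_nonneg (hM p.1 p.2) (pow_nonneg hs₀ _))]
  simp only [habs]
  refine (summable_prod_of_nonneg fun p => ?_).mpr
    ⟨fun k => (hasSum_pow_div_factorial_mul_multichoose hs' |y| k).summable, ?_⟩
  · exact mul_nonneg (by positivity) (mul_nonneg (hM _ _) (pow_nonneg hs₀ _))
  · simp only [(hasSum_pow_div_factorial_mul_multichoose hs' |y| _).tsum_eq]
    exact (hasSum_exp_div |y| s).summable

lemma hasSum_sum_antidiagonal_multichoose {s : ℝ} (hs₀ : 0 ≤ s) (hs : s < 1) (y : ℝ) :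
    HasSum (fun m : ℕ => ∑ p ∈ antidiagonal m, y ^ p.1 / p.1.factorial *
      (Ring.multichoose ((p.1 : ℝ) + 1 / 2) p.2 * s ^ p.2))
      (1 / √(1 - s) * Real.exp (y / (1 - s))) := by
  have hs' : |s| < 1 := by rwa [abs_of_nonneg hs₀]
  have h := (summable_pow_div_factorial_mul_multichoose hs₀ hs y).hasSum
  rw [(h.prod_fiberwise (hasSum_pow_div_factorial_mul_multichoose hs' y)).unique (hasSum_exp_div y s)] at h
  refine (HasAntidiagonal.sigmaAntidiagonalEquivProd.hasSum_iff.mpr h).sigma fun m => ?_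
  rw [← Finset.sum_attach]
  exact hasSum_fintype _

lemma mul_Hphys_two_mul (x t : ℝ) (m : ℕ) :
    (-1 : ℝ) ^ m / (Nat.factorial m : ℝ) * (t / 2) ^ (2 * m) * Hphys (2 * m) x =
      ∑ p ∈ antidiagonal m, (-(t * x) ^ 2) ^ p.1 / p.1.factorial *
        (Ring.multichoose ((p.1 : ℝ) + 1 / 2) p.2 * (t ^ 2) ^ p.2) := by
  rw [← Finset.Nat.sum_antidiagonal_swap, Finset.Nat.sum_antidiagonal_eq_sum_range_succ_mk, Hphys,
    Nat.mul_div_cancel_left m two_pos, Finset.mul_sum]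
  refine Finset.sum_congr rfl fun l hl => ?_
  obtain ⟨k, rfl⟩ := Nat.exists_eq_add_of_le' (Nat.le_of_lt_succ (Finset.mem_range.mp hl))
  rw [← Nat.mul_sub, Nat.add_sub_cancel]
  simp only [Prod.swap_prod_mk]
  rw [Ring.multichoose_add_half]
  have hsign : (-1 : ℝ) ^ (k + l) * (-1) ^ l = (-1) ^ k := by
    rw [pow_add, mul_assoc, ← mul_pow]; simp
  have hpow : (t / 2) ^ (2 * (k + l)) * (2 * x) ^ (2 * k) * 4 ^ l =
      ((t * x) ^ 2) ^ k * (t ^ 2) ^ l := by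
    have hx : (t * x) ^ 2 = (t / 2) ^ 2 * (2 * x) ^ 2 := by ring
    have ht : t ^ 2 = (t / 2) ^ 2 * 4 := by ring
    rw [hx, ht, mul_add, pow_add, pow_mul, pow_mul, pow_mul, mul_pow _ _ k, mul_pow _ _ l]
    ac_rfl
  rw [neg_pow ((t * x) ^ 2), ← hsign]
  calc _ = (-1) ^ (k + l) * (-1) ^ l * ((t / 2) ^ (2 * (k + l)) * (2 * x) ^ (2 * k) * 4 ^ l) *
        (2 * (k + l)).factorial /
          (l.factorial * (k + l).factorial * 4 ^ l * (2 * k).factorial) := by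
        generalize (t / 2) ^ (2 * (k + l)) = a
        generalize (2 * x) ^ (2 * k) = b
        field_simp
    _ = _ := by
        rw [hpow]
        field_simp

theorem even_hermite_generating_function (x t : ℝ) (ht : |t| < 1) :
    Summable (fun m : ℕ =>
      |(-1 : ℝ) ^ m / (Nat.factorial m : ℝ) * (t / 2) ^ (2 * m) * Hphys (2 * m) x|) ∧
    ∑' m : ℕ, (-1 : ℝ) ^ m / (Nat.factorial m : ℝ) * (t / 2) ^ (2 * m) * Hphys (2 * m) x =
      (1 / Real.sqrt (1 - t ^ 2)) * Real.exp (-(t * x) ^ 2 / (1 - t ^ 2)) := by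
  have hs : t ^ 2 < 1 := (sq_lt_one_iff_abs_lt_one t).mpr ht
  have h := hasSum_sum_antidiagonal_multichoose (sq_nonneg t) hs (-(t * x) ^ 2)
  simp only [← mul_Hphys_two_mul] at h
  exact ⟨h.summable.abs, h.tsum_eq⟩
end

section
/- For every real number x and every real number t with |t| < 1, the series Σ_{m=0}^∞ ((-1)^m / m!) (t/2)^{2m+1} H_{2m+1}(x) converges absolutely and equals (t x / (1 - t²)^{3/2}) · exp(-(t x)² / (1 - t²)). -/
open Finset

lemma ascPochhammer_eval_natCast_add_three_halves (k l : ℕ) :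
    (ascPochhammer ℝ l).eval ((k : ℝ) + 3 / 2) =
      (2 * (k + l) + 1).factorial * k.factorial /
        ((2 * k + 1).factorial * (k + l).factorial * 4 ^ l) := by
  induction l with
  | zero => simp; field_simp
  | succ l ih =>
    rw [ascPochhammer_succ_eval, ih, show 2 * (k + (l + 1)) + 1 = 2 * (k + l) + 1 + 1 + 1 by ring,
      ← add_assoc k l 1, Nat.factorial_succ (2 * (k + l) + 1 + 1),
      Nat.factorial_succ (2 * (k + l) + 1), Nat.factorial_succ (k + l)]
    push_cast
    field_simp
    ring

lemma hasSum_ascPochhammer_eval_div_factorial_mul_pow (a : ℝ) {y : ℝ} (hy : |y| < 1) :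
    HasSum (fun n : ℕ => (ascPochhammer ℝ n).eval a / n.factorial * y ^ n) (1 / (1 - y) ^ a) := by
  have h := (Real.one_div_one_sub_rpow_hasFPowerSeriesOnBall_zero a).hasSum (y := y)
    (by simpa [enorm_eq_nnnorm, ← NNReal.coe_lt_coe] using hy)
  simp only [FormalMultilinearSeries.ofScalars_apply_eq, zero_add, smul_eq_mul] at h
  refine h.congr_fun ?_
  intro n
  rw [← Ring.multichoose_eq, ← Polynomial.ascPochhammer_smeval_eq_eval,
    ← Ring.factorial_nsmul_multichoose_eq_ascPochhammer, nsmul_eq_mul]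
  field_simp

/-- The summand of the double series obtained by expanding the Hermite polynomials. -/
noncomputable def hermiteDoubleTerm (y z : ℝ) (p : ℕ × ℕ) : ℝ :=
  (ascPochhammer ℝ p.2).eval ((p.1 : ℝ) + 3 / 2) / p.2.factorial * y ^ p.2 *
    (z ^ p.1 / p.1.factorial)

lemma hasSum_hermiteDoubleTerm_snd {y : ℝ} (hy₀ : 0 ≤ y) (hy₁ : y < 1) (z : ℝ) (k : ℕ) :
    HasSum (fun l => hermiteDoubleTerm y z (k, l))
      (1 / √(1 - y) ^ 3 * ((z / (1 - y)) ^ k / k.factorial)) := by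
  have hy : 0 < 1 - y := by linarith
  have hpow : (1 - y) ^ ((k : ℝ) + 3 / 2) = (1 - y) ^ k * √(1 - y) ^ 3 := by
    rw [Real.rpow_add hy, Real.rpow_natCast, Real.sqrt_eq_rpow, ← Real.rpow_mul_natCast hy.le]
    norm_num
  have h := (hasSum_ascPochhammer_eval_div_factorial_mul_pow ((k : ℝ) + 3 / 2)
    (abs_lt.2 ⟨by linarith, hy₁⟩)).mul_right (z ^ k / k.factorial)
  rw [hpow] at h
  convert! h using 1
  rw [div_pow]
  field_simp

lemma hasSum_inv_sqrt_pow_mul_exp (y z : ℝ) :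
    HasSum (fun k : ℕ => 1 / √(1 - y) ^ 3 * ((z / (1 - y)) ^ k / k.factorial))
      (1 / √(1 - y) ^ 3 * Real.exp (z / (1 - y))) := by
  rw [Real.exp_eq_exp_ℝ]
  exact (NormedSpace.expSeries_div_hasSum_exp (z / (1 - y))).mul_left _

lemma abs_hermiteDoubleTerm {y : ℝ} (hy₀ : 0 ≤ y) (z : ℝ) (p : ℕ × ℕ) :
    |hermiteDoubleTerm y z p| = hermiteDoubleTerm y |z| p := by
  have h : 0 < (ascPochhammer ℝ p.2).eval ((p.1 : ℝ) + 3 / 2) :=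
    ascPochhammer_pos _ _ (by positivity)
  rw [hermiteDoubleTerm, hermiteDoubleTerm, abs_mul, abs_of_nonneg (by positivity), abs_div,
    abs_pow, Nat.abs_cast]

lemma hasSum_hermiteDoubleTerm {y : ℝ} (hy₀ : 0 ≤ y) (hy₁ : y < 1) (z : ℝ) :
    HasSum (hermiteDoubleTerm y z) (1 / √(1 - y) ^ 3 * Real.exp (z / (1 - y))) := by
  have hsum : Summable (hermiteDoubleTerm y z) := by
    refine Summable.of_abs ?_
    simp only [abs_hermiteDoubleTerm hy₀]
    refine (summable_prod_of_nonneg fun p => ?_).2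
      ⟨fun k => (hasSum_hermiteDoubleTerm_snd hy₀ hy₁ |z| k).summable, ?_⟩
    · rw [← abs_hermiteDoubleTerm hy₀]
      exact abs_nonneg _
    · simp only [(hasSum_hermiteDoubleTerm_snd hy₀ hy₁ |z| _).tsum_eq]
      exact (hasSum_inv_sqrt_pow_mul_exp y |z|).summable
  have h := hsum.hasSum.prod_fiberwise (hasSum_hermiteDoubleTerm_snd hy₀ hy₁ z)
  rw [← h.unique (hasSum_inv_sqrt_pow_mul_exp y z)]
  exact hsum.hasSum

lemma odd_Hphys_term_eq_sum_antidiagonal (x t : ℝ) (m : ℕ) :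
    (-1 : ℝ) ^ m / (Nat.factorial m : ℝ) * (t / 2) ^ (2 * m + 1) * Hphys (2 * m + 1) x =
      t * x * ∑ p ∈ antidiagonal m, hermiteDoubleTerm (t ^ 2) (-(t * x) ^ 2) p := by
  rw [← Finset.Nat.sum_antidiagonal_swap, Finset.Nat.sum_antidiagonal_eq_sum_range_succ_mk, Hphys,
    show (2 * m + 1) / 2 + 1 = m.succ by omega, Finset.mul_sum, Finset.mul_sum]
  refine Finset.sum_congr rfl fun l hl => ?_
  obtain ⟨k, rfl⟩ : ∃ k, m = k + l :=
    ⟨m - l, (Nat.sub_add_cancel (Nat.lt_succ_iff.1 (Finset.mem_range.1 hl))).symm⟩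
  have hsign : (-1 : ℝ) ^ (k + l) * (-1) ^ l = (-1) ^ k := by
    rw [pow_add, mul_assoc, ← mul_pow]; norm_num
  rw [show 2 * (k + l) + 1 - 2 * l = 2 * k + 1 by omega]
  simp only [Prod.swap, hermiteDoubleTerm, Nat.add_sub_cancel,
    ascPochhammer_eval_natCast_add_three_halves]
  rw [neg_pow ((t * x) ^ 2), ← hsign, show (4 : ℝ) = 2 ^ 2 by norm_num]
  simp only [div_pow, mul_pow, ← pow_mul]
  field_simp
  ring

theorem odd_hermite_generating_function (x t : ℝ) (ht : |t| < 1) :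
    Summable (fun m : ℕ =>
      |(-1 : ℝ) ^ m / (Nat.factorial m : ℝ) * (t / 2) ^ (2 * m + 1) * Hphys (2 * m + 1) x|) ∧
    ∑' m : ℕ, (-1 : ℝ) ^ m / (Nat.factorial m : ℝ) * (t / 2) ^ (2 * m + 1) *
        Hphys (2 * m + 1) x =
      (t * x / (Real.sqrt (1 - t ^ 2)) ^ 3) * Real.exp (-(t * x) ^ 2 / (1 - t ^ 2)) := by
  have hdouble := hasSum_hermiteDoubleTerm (sq_nonneg t) ((sq_lt_one_iff_abs_lt_one t).2 ht)
    (-(t * x) ^ 2)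
  have hsum : HasSum (fun m : ℕ => (-1 : ℝ) ^ m / (Nat.factorial m : ℝ) *
      (t / 2) ^ (2 * m + 1) * Hphys (2 * m + 1) x)
      (t * x / √(1 - t ^ 2) ^ 3 * Real.exp (-(t * x) ^ 2 / (1 - t ^ 2))) := by
    simp only [odd_Hphys_term_eq_sum_antidiagonal]
    rw [div_eq_mul_one_div, mul_assoc]
    refine HasSum.mul_left _ ?_
    refine (HasAntidiagonal.sigmaAntidiagonalEquivProd.hasSum_iff.2 hdouble).sigma fun m => ?_
    exact (antidiagonal m).hasSum _
  exact ⟨hsum.summable.abs, hsum.tsum_eq⟩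
end

section
/- For all real numbers x and t, the series Σ_{m=0}^∞ (t^{2m} / (2m)!) H_{2m}(x) converges absolutely and equals exp(-t²)·cosh(2tx), and the series Σ_{m=0}^∞ (t^{2m+1} / (2m+1)!) H_{2m+1}(x) converges absolutely and equals exp(-t²)·sinh(2tx). -/
open Finset

/-- A normalized Hermite polynomial, with the parity of its index fixed by `r`, is a coefficient
of a Cauchy product. -/
lemma hermite_term_eq_sum_range (r : ℕ) (hr : r < 2) (m : ℕ) (x t : ℝ) :
    t ^ (2 * m + r) / (Nat.factorial (2 * m + r) : ℝ) * Hphys (2 * m + r) x =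
      ∑ l ∈ Finset.range (m + 1), (-t ^ 2) ^ l / (Nat.factorial l : ℝ) *
        ((2 * t * x) ^ (2 * (m - l) + r) / (Nat.factorial (2 * (m - l) + r) : ℝ)) := by
  have hm : (2 * m + r) / 2 = m := by omega
  rw [Hphys, hm, Finset.mul_sum]
  refine Finset.sum_congr rfl fun l hl => ?_
  obtain ⟨k, rfl⟩ := Nat.exists_eq_add_of_le (Nat.lt_succ_iff.mp (Finset.mem_range.mp hl))
  have hsub : 2 * (l + k) + r - 2 * l = 2 * k + r := by omega
  have hfact : ((2 * (l + k) + r).factorial : ℝ) ≠ 0 := by positivity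
  rw [hsub, Nat.add_sub_cancel_left, neg_pow (t ^ 2)]
  field_simp
  ring

/-- The Cauchy product behind the Hermite generating functions of a fixed parity. -/
lemma hermite_series_of_hasSum (r : ℕ) (hr : r < 2) (x t S : ℝ)
    (h : HasSum (fun k : ℕ =>
      (2 * t * x) ^ (2 * k + r) / (Nat.factorial (2 * k + r) : ℝ)) S) :
    Summable (fun m : ℕ =>
      |t ^ (2 * m + r) / (Nat.factorial (2 * m + r) : ℝ) * Hphys (2 * m + r) x|) ∧
    ∑' m : ℕ, t ^ (2 * m + r) / (Nat.factorial (2 * m + r) : ℝ) * Hphys (2 * m + r) x =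
      Real.exp (-t ^ 2) * S := by
  have hexp := NormedSpace.expSeries_div_hasSum_exp (-t ^ 2)
  simp only [hermite_term_eq_sum_range r hr]
  have hsum := summable_norm_sum_mul_range_of_summable_norm hexp.summable.norm h.summable.norm
  have htsum := tsum_mul_tsum_eq_tsum_sum_range_of_summable_norm hexp.summable.norm h.summable.norm
  rw [hexp.tsum_eq, h.tsum_eq, ← Real.exp_eq_exp_ℝ] at htsum
  simp only [Real.norm_eq_abs] at hsum
  exact ⟨hsum, htsum.symm⟩

theorem even_odd_hermite_exponential_generating_functions (x t : ℝ) :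
    (Summable (fun m : ℕ => |t ^ (2 * m) / (Nat.factorial (2 * m) : ℝ) * Hphys (2 * m) x|) ∧
      ∑' m : ℕ, t ^ (2 * m) / (Nat.factorial (2 * m) : ℝ) * Hphys (2 * m) x =
        Real.exp (-t ^ 2) * Real.cosh (2 * t * x)) ∧
    (Summable (fun m : ℕ =>
        |t ^ (2 * m + 1) / (Nat.factorial (2 * m + 1) : ℝ) * Hphys (2 * m + 1) x|) ∧
      ∑' m : ℕ, t ^ (2 * m + 1) / (Nat.factorial (2 * m + 1) : ℝ) * Hphys (2 * m + 1) x =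
        Real.exp (-t ^ 2) * Real.sinh (2 * t * x)) := by
  exact ⟨hermite_series_of_hasSum 0 two_pos x t _ (Real.hasSum_cosh _),
    hermite_series_of_hasSum 1 one_lt_two x t _ (Real.hasSum_sinh _)⟩
end

section
/- For all complex numbers z, z' and every complex number t with |t| < 1, the series Σ_{n=0}^∞ ((-t)^n / n!) L_{n,n}(z,z') converges absolutely and equals (1/(1-t)) · exp(-t z z' / (1 - t)). -/
open Finset

theorem HasSum.sum_antidiagonal {α : Type*} [AddCommMonoid α] [TopologicalSpace α]
    [ContinuousAdd α] [RegularSpace α] {f : ℕ × ℕ → α} {a : α} (hf : HasSum f a) :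
    HasSum (fun n => ∑ p ∈ HasAntidiagonal.antidiagonal n, f p) a :=
  (HasAntidiagonal.sigmaAntidiagonalEquivProd.hasSum_iff.mpr hf).sigma
    fun n => (HasAntidiagonal.antidiagonal n).hasSum f

theorem hasSum_choose_mul_geometric_mul_pow_div_factorial {𝕜 : Type*} [RCLike 𝕜] (k : ℕ)
    (x : 𝕜) {r : 𝕜} (hr : ‖r‖ < 1) :
    HasSum (fun j : ℕ => ((j + k).choose k : 𝕜) * r ^ j * (x ^ k / (k.factorial : 𝕜)))
      (1 / (1 - r) * ((x / (1 - r)) ^ k / (k.factorial : 𝕜))) := by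
  have hr' : 1 - r ≠ 0 := by
    intro h
    rw [← sub_eq_zero.mp h] at hr
    simp at hr
  convert! (hasSum_choose_mul_geometric_of_norm_lt_one k hr).mul_right
    (x ^ k / (k.factorial : 𝕜)) using 1
  have hk : (k.factorial : 𝕜) ≠ 0 := Nat.cast_ne_zero.mpr k.factorial_ne_zero
  rw [div_pow, pow_succ]
  field_simp

theorem summable_norm_choose_mul_geometric_mul_pow_div_factorial (x : ℂ) {t : ℂ}
    (ht : ‖t‖ < 1) :
    Summable (fun p : ℕ × ℕ =>
      ‖((p.2 + p.1).choose p.1 : ℂ) * t ^ p.2 * (x ^ p.1 / (p.1.factorial : ℂ))‖) := by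
  have ht' : ‖(‖t‖ : ℝ)‖ < 1 := by simpa using ht
  have h := fun k : ℕ =>
    hasSum_choose_mul_geometric_mul_pow_div_factorial k ‖x‖ ht'
  rw [summable_prod_of_nonneg (fun p => norm_nonneg _)]
  simp only [norm_mul, norm_div, norm_pow, RCLike.norm_natCast]
  refine ⟨fun k => (h k).summable, ?_⟩
  simp_rw [fun k => (h k).tsum_eq]
  exact (Real.summable_pow_div_factorial _).mul_left _

theorem pow_div_factorial_mul_L2D_eq_sum_antidiagonal (z z' t : ℂ) (n : ℕ) :
    (-t) ^ n / (Nat.factorial n : ℂ) * L2D n n z z' =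
      ∑ p ∈ HasAntidiagonal.antidiagonal n, ((p.2 + p.1).choose p.1 : ℂ) * t ^ p.2 *
        ((-t * z * z') ^ p.1 / (p.1.factorial : ℂ)) := by
  rw [← Finset.Nat.sum_antidiagonal_swap, Finset.Nat.sum_antidiagonal_eq_sum_range_succ_mk, L2D,
    min_self, Finset.mul_sum]
  refine Finset.sum_congr rfl fun j hj => ?_
  obtain ⟨k, rfl⟩ := Nat.exists_eq_add_of_le (Nat.lt_succ_iff.mp (Finset.mem_range.mp hj))
  simp only [Nat.add_sub_cancel_left, Prod.swap]
  rw [← Nat.choose_symm_add, Nat.cast_add_choose ℂ]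
  have h1 : ((j + k).factorial : ℂ) ≠ 0 := Nat.cast_ne_zero.mpr (Nat.factorial_ne_zero _)
  have h2 : (j.factorial : ℂ) ≠ 0 := Nat.cast_ne_zero.mpr (Nat.factorial_ne_zero _)
  have h3 : (k.factorial : ℂ) ≠ 0 := Nat.cast_ne_zero.mpr (Nat.factorial_ne_zero _)
  have h4 : (-t) ^ (j + k) * (-1) ^ j = t ^ j * (-t) ^ k := by
    rw [pow_add, mul_right_comm, ← mul_pow, neg_mul_neg, mul_one]
  field_simp
  linear_combination (z ^ k * z' ^ k) * h4

theorem L2D_diagonal_generating_function (z z' t : ℂ) (ht : ‖t‖ < 1) :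
    Summable (fun n : ℕ => ‖(-t) ^ n / (Nat.factorial n : ℂ) * L2D n n z z'‖) ∧
    ∑' n : ℕ, (-t) ^ n / (Nat.factorial n : ℂ) * L2D n n z z' =
      (1 / (1 - t)) * Complex.exp (-t * z * z' / (1 - t)) := by
  simp only [pow_div_factorial_mul_L2D_eq_sum_antidiagonal]
  set f : ℕ × ℕ → ℂ := fun p => ((p.2 + p.1).choose p.1 : ℂ) * t ^ p.2 *
    ((-t * z * z') ^ p.1 / (p.1.factorial : ℂ))
  have hs : Summable fun p => ‖f p‖ :=
    summable_norm_choose_mul_geometric_mul_pow_div_factorial (-t * z * z') ht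
  have hrow := fun k : ℕ =>
    hasSum_choose_mul_geometric_mul_pow_div_factorial k (-t * z * z') ht
  constructor
  · exact hs.hasSum.sum_antidiagonal.summable.of_nonneg_of_le (fun n => norm_nonneg _)
      fun n => norm_sum_le _ _
  · have hexp : HasSum (fun k : ℕ => 1 / (1 - t) *
        ((-t * z * z' / (1 - t)) ^ k / (k.factorial : ℂ)))
        (1 / (1 - t) * Complex.exp (-t * z * z' / (1 - t))) := by
      rw [Complex.exp_eq_exp_ℂ]
      exact (NormedSpace.expSeries_div_hasSum_exp (-t * z * z' / (1 - t))).mul_left (1 / (1 - t))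
    have hsum : HasSum f (∑' p, f p) := hs.of_norm.hasSum
    rw [← (hsum.prod_fiberwise hrow).unique hexp]
    exact hsum.sum_antidiagonal.tsum_eq
end

section
/- For all real numbers s, t, u, v with |st| < 1 and all complex numbers z, z', the double series Σ_{m=0}^∞ Σ_{n=0}^∞ (s^m t^n / (2^{(m+n)/2} m! n!)) L_{m,n}(z,z') H_m(u) H_n(v) converges absolutely and equals (1 - s²t²)^{-1/2} · exp( (2√2·(s u z + t v z' + st(s v z + t u z')) - s² z² - t² z'² - 4 s t u v - 2 s² t² (z z' + u² + v²)) / (2(1 - s²t²)) ). -/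
open Finset

/-- The physicists' Hermite polynomials at a complex argument. -/
noncomputable def hermiteC (n : ℕ) (x : ℂ) : ℂ :=
  ∑ l ∈ Finset.range (n / 2 + 1),
    (-1 : ℂ) ^ l * (Nat.factorial n : ℂ) /
      ((Nat.factorial l : ℂ) * (Nat.factorial (n - 2 * l) : ℂ)) * (2 * x) ^ (n - 2 * l)

theorem hermiteC_zero (x : ℂ) : hermiteC 0 x = 1 := by simp [hermiteC]

theorem hermiteC_one (x : ℂ) : hermiteC 1 x = 2 * x := by simp [hermiteC]

/-- The summand of `hermiteC`, extended by zero. -/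
noncomputable def hermiteTerm (x : ℂ) (n l : ℕ) : ℂ :=
  if 2 * l ≤ n then (-1 : ℂ) ^ l * (Nat.factorial n : ℂ) /
      ((Nat.factorial l : ℂ) * (Nat.factorial (n - 2 * l) : ℂ)) * (2 * x) ^ (n - 2 * l) else 0

theorem hermiteC_eq_sum_hermiteTerm (x : ℂ) {n N : ℕ} (h : n < 2 * N) :
    hermiteC n x = ∑ l ∈ range N, hermiteTerm x n l := by
  have hsub : range (n / 2 + 1) ⊆ range N := by
    intro l hl
    simp only [mem_range] at *
    omega
  rw [← sum_subset hsub]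
  · refine sum_congr rfl fun l hl => ?_
    rw [hermiteTerm, if_pos]
    simp only [mem_range] at hl
    omega
  · intro l _ hl
    rw [hermiteTerm, if_neg]
    simp only [mem_range] at hl
    omega

theorem hermiteTerm_zero_right (x : ℂ) (n : ℕ) : hermiteTerm x n 0 = (2 * x) ^ n := by
  have := Nat.factorial_ne_zero n
  simp [hermiteTerm, this]

theorem hermiteTerm_succ (x : ℂ) (n l : ℕ) :
    hermiteTerm x (n + 2) (l + 1) =
      2 * x * hermiteTerm x (n + 1) (l + 1) - 2 * (n + 1) * hermiteTerm x n l := by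
  have hl := Nat.factorial_ne_zero l
  rcases lt_trichotomy n (2 * l) with h | rfl | h
  · simp only [hermiteTerm]
    rw [if_neg (by omega), if_neg (by omega), if_neg (by omega)]
    ring
  · simp only [hermiteTerm]
    rw [if_pos (by omega), if_neg (by omega), if_pos le_rfl]
    simp only [show 2 * l + 2 - 2 * (l + 1) = 0 by omega, Nat.sub_self, Nat.factorial_succ]
    push_cast
    field_simp
    ring
  · obtain ⟨k, rfl⟩ := Nat.exists_eq_add_of_lt h
    have hk := Nat.factorial_ne_zero k
    simp only [hermiteTerm]
    rw [if_pos (by omega), if_pos (by omega), if_pos (by omega)]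
    simp only [show 2 * l + k + 1 + 2 - 2 * (l + 1) = k + 1 by omega,
      show 2 * l + k + 1 + 1 - 2 * (l + 1) = k by omega,
      show 2 * l + k + 1 - 2 * l = k + 1 by omega, Nat.factorial_succ]
    push_cast
    have : (k : ℂ) + 1 ≠ 0 := by exact_mod_cast k.succ_ne_zero
    field_simp
    ring

theorem hermiteC_add_two (n : ℕ) (x : ℂ) :
    hermiteC (n + 2) x = 2 * x * hermiteC (n + 1) x - 2 * (n + 1) * hermiteC n x := by
  rw [hermiteC_eq_sum_hermiteTerm x (show n + 2 < 2 * (n + 2 + 1) by omega),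
    hermiteC_eq_sum_hermiteTerm x (show n + 1 < 2 * (n + 2 + 1) by omega),
    hermiteC_eq_sum_hermiteTerm x (show n < 2 * (n + 2) by omega),
    sum_range_succ' _ (n + 2), sum_range_succ' _ (n + 2)]
  simp only [hermiteTerm_succ, hermiteTerm_zero_right, sum_sub_distrib, ← mul_sum]
  ring

theorem hermiteC_succ (n : ℕ) (x : ℂ) :
    hermiteC (n + 1) x = 2 * x * hermiteC n x - 2 * n * hermiteC (n - 1) x := by
  cases n with
  | zero => simp [hermiteC_zero, hermiteC_one]
  | succ n => simpa using hermiteC_add_two n x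

/-- Sequences of order at most `√(2 ^ n * n!)` up to subexponential factors, in a form that
separates the contributions of the two summands of an index. -/
def HermiteGrowth (f : ℕ → ℂ) : Prop :=
  ∀ σ : ℝ, 1 < σ → ∃ C A : ℝ, 0 ≤ C ∧ 0 ≤ A ∧ ∀ j a : ℕ,
    ‖f (j + a)‖ ≤ C * ((σ * √2) ^ j * √(Nat.factorial j)) * (A ^ a * √(Nat.factorial a))

theorem sqrt_factorial_add_le {ρ : ℝ} (hρ : 1 < ρ) (j a : ℕ) :
    √(Nat.factorial (j + a)) ≤
      (ρ ^ j * √(Nat.factorial j)) * ((ρ / √(ρ ^ 2 - 1)) ^ a * √(Nat.factorial a)) := by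
  have hδ : 0 < ρ ^ 2 - 1 := by nlinarith
  have key : ((j + a).choose j : ℝ) * (ρ ^ 2 - 1) ^ a ≤ (ρ ^ 2) ^ (j + a) := by
    have h := add_pow (1 : ℝ) (ρ ^ 2 - 1) (j + a)
    rw [add_sub_cancel] at h
    rw [h]
    have := single_le_sum (f := fun m => (1 : ℝ) ^ m * (ρ ^ 2 - 1) ^ (j + a - m) * ((j + a).choose m))
      (fun i _ => by positivity) (mem_range.2 (show j < j + a + 1 by omega))
    simpa [mul_comm] using this
  have hfac : (Nat.factorial (j + a) : ℝ) =
      (j + a).choose j * Nat.factorial j * Nat.factorial a := by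
    rw [Nat.choose_symm_add]
    exact_mod_cast (Nat.add_choose_mul_factorial_mul_factorial j a).symm
  have hs := Real.sq_sqrt hδ.le
  have hs0 := Real.sqrt_pos.2 hδ
  refine Real.sqrt_le_iff.2 ⟨by positivity, ?_⟩
  rw [hfac]
  have e : ((ρ ^ j * √(Nat.factorial j : ℝ)) *
      ((ρ / √(ρ ^ 2 - 1)) ^ a * √(Nat.factorial a : ℝ))) ^ 2 =
      (ρ ^ 2) ^ (j + a) / (ρ ^ 2 - 1) ^ a * Nat.factorial j * Nat.factorial a := by
    rw [mul_pow, mul_pow, mul_pow, Real.sq_sqrt (by positivity), Real.sq_sqrt (by positivity),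
      div_pow, div_pow, ← pow_mul (√_), mul_comm a 2, pow_mul (√_), hs]
    ring
  rw [e]
  gcongr
  rwa [le_div_iff₀ (by positivity)]

theorem HermiteGrowth.of_forall_le {f : ℕ → ℂ}
    (h : ∀ ρ : ℝ, 1 < ρ → ∃ C : ℝ, 0 ≤ C ∧ ∀ n,
      ‖f n‖ ≤ C * ((ρ * √2) ^ n * √(Nat.factorial n))) : HermiteGrowth f := by
  intro σ hσ
  have hρ : 1 < √σ := by rw [Real.lt_sqrt (by norm_num)]; simpa
  have hρ2 : √σ * √σ = σ := Real.mul_self_sqrt (by linarith)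
  obtain ⟨C, hC, hf⟩ := h _ hρ
  refine ⟨C, √σ * √2 * (√σ / √(√σ ^ 2 - 1)), hC, by positivity, fun j a => ?_⟩
  calc ‖f (j + a)‖ ≤ C * ((√σ * √2) ^ (j + a) * √(Nat.factorial (j + a))) := hf _
    _ ≤ C * ((√σ * √2) ^ (j + a) * ((√σ ^ j * √(Nat.factorial j)) *
        ((√σ / √(√σ ^ 2 - 1)) ^ a * √(Nat.factorial a)))) := by
      gcongr
      exact sqrt_factorial_add_le hρ j a
    _ = C * ((√σ * √σ * √2) ^ j * √(Nat.factorial j)) *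
        ((√σ * √2 * (√σ / √(√σ ^ 2 - 1))) ^ a * √(Nat.factorial a)) := by ring
    _ = _ := by rw [hρ2]

theorem hermiteGrowth_one : HermiteGrowth fun _ => 1 := by
  refine .of_forall_le fun ρ hρ => ⟨1, zero_le_one, fun n => ?_⟩
  have h2 : 1 ≤ √2 := Real.one_le_sqrt.2 (by norm_num)
  have h3 : 1 ≤ √(Nat.factorial n : ℝ) :=
    Real.one_le_sqrt.2 (by exact_mod_cast Nat.factorial_pos n)
  simpa using one_le_mul_of_one_le_of_one_le (one_le_pow₀ (n := n)
    (one_le_mul_of_one_le_of_one_le hρ.le h2)) h3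

theorem hermiteGrowth_hermiteC (x : ℂ) : HermiteGrowth fun n => hermiteC n x := by
  refine .of_forall_le fun ρ hρ => ?_
  have h2 : 1 ≤ √2 := Real.one_le_sqrt.2 (by norm_num)
  have hev : ∀ᶠ n : ℕ in Filter.atTop, 2 * ‖x‖ * ρ / ((ρ ^ 2 - 1) * √2) ≤ √((n : ℝ) + 1) :=
    (Real.tendsto_sqrt_atTop.comp (Filter.tendsto_atTop_add_const_right _ _
      tendsto_natCast_atTop_atTop)).eventually_ge_atTop _
  obtain ⟨N, hN⟩ := Filter.eventually_atTop.1 hev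
  set C := ∑ i ∈ range (N + 2), ‖hermiteC i x‖ with hCdef
  have hC : 0 ≤ C := sum_nonneg fun i _ => norm_nonneg _
  refine ⟨C, hC, fun n => ?_⟩
  induction n using Nat.strong_induction_on with
  | _ n ih =>
    by_cases hn : n < N + 2
    · have h3 : 1 ≤ √(Nat.factorial n : ℝ) :=
        Real.one_le_sqrt.2 (by exact_mod_cast Nat.factorial_pos n)
      have h4 := one_le_mul_of_one_le_of_one_le (one_le_pow₀ (n := n)
        (one_le_mul_of_one_le_of_one_le hρ.le h2)) h3
      exact (single_le_sum (f := fun i => ‖hermiteC i x‖) (fun i _ => norm_nonneg _)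
        (mem_range.2 hn)).trans (le_mul_of_one_le_right hC h4)
    · obtain ⟨n, rfl⟩ := Nat.exists_eq_add_of_le (show 2 ≤ n by omega)
      rw [add_comm 2 n] at *
      have h0 := ih n (by omega)
      have h1 := ih (n + 1) (by omega)
      have hb := hN n (by omega)
      have hδ : 0 < ρ ^ 2 - 1 := by nlinarith
      rw [div_le_iff₀ (by positivity)] at hb
      have hmono : √((n : ℝ) + 1) ≤ √((n : ℝ) + 2) := Real.sqrt_le_sqrt (by linarith)
      have hsq := Real.mul_self_sqrt (show (0 : ℝ) ≤ (n : ℝ) + 1 by positivity)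
      have hsq2 := Real.mul_self_sqrt (show (0 : ℝ) ≤ 2 by norm_num)
      have f1 : √(Nat.factorial (n + 1) : ℝ) = √((n : ℝ) + 1) * √(Nat.factorial n : ℝ) := by
        rw [Nat.factorial_succ, ← Real.sqrt_mul (by positivity)]
        push_cast
        rfl
      have f2 : √(Nat.factorial (n + 2) : ℝ) =
          √((n : ℝ) + 2) * (√((n : ℝ) + 1) * √(Nat.factorial n : ℝ)) := by
        rw [← f1, Nat.factorial_succ (n + 1), ← Real.sqrt_mul (by positivity)]
        push_cast
        ring_nf
      rw [f1] at h1
      rw [f2, hermiteC_add_two]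
      set p := √((n : ℝ) + 1)
      set q := √((n : ℝ) + 2)
      set w := (ρ * √2) ^ n * √(Nat.factorial n : ℝ) with hw
      have hw0 : 0 ≤ w := by positivity
      calc ‖2 * x * hermiteC (n + 1) x - 2 * (n + 1) * hermiteC n x‖
          ≤ 2 * ‖x‖ * ‖hermiteC (n + 1) x‖ + 2 * (n + 1) * ‖hermiteC n x‖ := by
            refine (norm_sub_le _ _).trans (le_of_eq ?_)
            have : ‖(n : ℂ) + 1‖ = n + 1 := by exact_mod_cast Complex.norm_natCast (n + 1)
            simp [this]
        _ ≤ 2 * ‖x‖ * (C * ((ρ * √2) ^ (n + 1) * (p * √(Nat.factorial n)))) +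
            2 * (n + 1) * (C * w) := by gcongr
        _ = C * w * (√2 * p) * (2 * ‖x‖ * ρ + √2 * p) := by
            rw [← hsq, hw, pow_succ]
            linear_combination (-C * ((ρ * √2) ^ n * √(Nat.factorial n : ℝ)) * p * p) * hsq2
        _ ≤ C * w * (√2 * p) * (ρ ^ 2 * (√2 * q)) := by
            gcongr
            nlinarith [mul_le_mul_of_nonneg_left hmono (show 0 ≤ ρ ^ 2 * √2 by positivity)]
        _ = _ := by rw [hw]; ring

theorem summable_pow_div_sqrt_factorial (X : ℝ) :
    Summable fun n : ℕ => X ^ n / √(Nat.factorial n) := by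
  refine .of_norm_bounded (g := fun n : ℕ => (2 * X ^ 2) ^ n / Nat.factorial n + (1 / 2) ^ n)
    ((Real.summable_pow_div_factorial _).add
      (summable_geometric_of_lt_one (by norm_num) (by norm_num))) fun n => ?_
  have hs : 0 < √(Nat.factorial n : ℝ) := by positivity
  have h := two_mul_le_add_sq ((√2 * |X|) ^ n / √(Nat.factorial n)) ((1 / √2) ^ n)
  have e1 : ((√2 * |X|) ^ n / √(Nat.factorial n : ℝ)) ^ 2 = (2 * X ^ 2) ^ n / Nat.factorial n := by
    rw [div_pow, Real.sq_sqrt (by positivity), ← pow_mul, mul_comm n, pow_mul, mul_pow, sq_abs,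
      Real.sq_sqrt (by norm_num)]
  have e2 : ((1 / √2 : ℝ) ^ n) ^ 2 = (1 / 2) ^ n := by
    rw [← pow_mul, mul_comm n, pow_mul, div_pow, Real.sq_sqrt (by norm_num), one_pow]
  have e3 : (√2 * |X|) ^ n / √(Nat.factorial n : ℝ) * (1 / √2) ^ n =
      |X| ^ n / √(Nat.factorial n) := by
    rw [div_mul_eq_mul_div, ← mul_pow]
    congr 2
    field_simp
  rw [e1, e2, mul_assoc, e3] at h
  rw [norm_div, norm_pow, Real.norm_eq_abs, Real.norm_of_nonneg hs.le]
  have : 0 ≤ |X| ^ n / √(Nat.factorial n : ℝ) := by positivity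
  linarith

theorem HermiteGrowth.summable_triple {f g : ℕ → ℂ} (hf : HermiteGrowth f) (hg : HermiteGrowth g)
    {r : ℂ} (hr : ‖r‖ < 1 / 2) (α β : ℂ) :
    Summable fun p : ℕ × ℕ × ℕ => r ^ p.1 / Nat.factorial p.1 *
      ((α ^ p.2.1 / Nat.factorial p.2.1 * f (p.1 + p.2.1)) *
        (β ^ p.2.2 / Nat.factorial p.2.2 * g (p.1 + p.2.2))) := by
  obtain ⟨σ, hσr, hσ⟩ : ∃ σ : ℝ, 2 * ‖r‖ * σ ^ 2 < 1 ∧ 1 < σ := by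
    have hc : ContinuousAt (fun σ : ℝ => 2 * ‖r‖ * σ ^ 2) 1 := by fun_prop
    have h1 : ∀ᶠ σ in nhdsWithin (1 : ℝ) (Set.Ioi 1), 2 * ‖r‖ * σ ^ 2 < 1 :=
      (hc.eventually_lt_const (by linarith)).filter_mono nhdsWithin_le_nhds
    exact (h1.and self_mem_nhdsWithin).exists
  obtain ⟨C, A, hC, hA, hfb⟩ := hf σ hσ
  obtain ⟨D, B, hD, hB, hgb⟩ := hg σ hσ
  have hj := (summable_geometric_of_lt_one (by positivity) hσr).mul_left (C * D)
  have hab := (summable_pow_div_sqrt_factorial (‖α‖ * A)).mul_of_nonneg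
    (summable_pow_div_sqrt_factorial (‖β‖ * B))
    (fun _ => by positivity) (fun _ => by positivity)
  refine .of_norm_bounded (hj.mul_of_nonneg hab (fun _ => by positivity)
    (fun _ => by positivity)) ?_
  rintro ⟨j, a, b⟩
  simp only [norm_mul, norm_div, norm_pow, Complex.norm_natCast]
  have sq (n : ℕ) : (Nat.factorial n : ℝ) = √(Nat.factorial n) * √(Nat.factorial n) :=
    (Real.mul_self_sqrt (by positivity)).symm
  have h2 := Real.sq_sqrt (show (0 : ℝ) ≤ 2 by norm_num)
  calc _ ≤ ‖r‖ ^ j / Nat.factorial j *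
        (‖α‖ ^ a / Nat.factorial a *
          (C * ((σ * √2) ^ j * √(Nat.factorial j)) * (A ^ a * √(Nat.factorial a))) *
        (‖β‖ ^ b / Nat.factorial b *
          (D * ((σ * √2) ^ j * √(Nat.factorial j)) * (B ^ b * √(Nat.factorial b))))) := by
        gcongr
        · exact hfb j a
        · exact hgb j b
    _ = _ := by
        have e : (2 * ‖r‖ * σ ^ 2) ^ j = ‖r‖ ^ j * ((σ * √2) ^ j * (σ * √2) ^ j) := by
          rw [← mul_pow, ← mul_pow]
          congr 1
          linear_combination (-‖r‖ * σ ^ 2) * h2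
        have p (n : ℕ) : 0 < √(Nat.factorial n : ℝ) := by positivity
        have pj := p j
        have pa := p a
        have pb := p b
        rw [e, sq j, sq a, sq b]
        generalize √(Nat.factorial j : ℝ) = x at *
        generalize √(Nat.factorial a : ℝ) = y at *
        generalize √(Nat.factorial b : ℝ) = w at *
        simp only [mul_pow ‖α‖, mul_pow ‖β‖, Real.sqrt_mul_self pj.le, Real.sqrt_mul_self pa.le,
          Real.sqrt_mul_self pb.le]
        field_simp

theorem HermiteGrowth.summable_mul_shift {f g : ℕ → ℂ} (hf : HermiteGrowth f)
    (hg : HermiteGrowth g) {r : ℂ} (hr : ‖r‖ < 1 / 2) (a b : ℕ) :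
    Summable fun n : ℕ => r ^ n / Nat.factorial n * (f (n + a) * g (n + b)) := by
  have hinj : Function.Injective fun n : ℕ => (n, a, b) := fun m n h => congrArg Prod.fst h
  have h := ((hf.summable_triple hg hr 1 1).comp_injective hinj).mul_left
    ((Nat.factorial a : ℂ) * Nat.factorial b)
  refine h.congr fun n => ?_
  have ha : (Nat.factorial a : ℂ) ≠ 0 := by exact_mod_cast a.factorial_ne_zero
  have hb : (Nat.factorial b : ℂ) ≠ 0 := by exact_mod_cast b.factorial_ne_zero
  simp only [Function.comp_apply, one_pow]
  field_simp

theorem HermiteGrowth.summable_shift {f : ℕ → ℂ} (hf : HermiteGrowth f) (j : ℕ) (α : ℂ) :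
    Summable fun n : ℕ => α ^ n / Nat.factorial n * f (j + n) := by
  have hinj : Function.Injective fun n : ℕ => (j, n, 0) :=
    fun m n h => congrArg (fun p : ℕ × ℕ × ℕ => p.2.1) h
  have h := ((hf.summable_triple hermiteGrowth_one (r := 1 / 4) (by norm_num) α
    1).comp_injective hinj).mul_left ((Nat.factorial j : ℂ) * 4 ^ j)
  refine h.congr fun n => ?_
  have hj : (Nat.factorial j : ℂ) ≠ 0 := by exact_mod_cast j.factorial_ne_zero
  simp only [Function.comp_apply, pow_zero, Nat.factorial_zero]
  field_simp
  simp

theorem pow_succ_div_factorial_mul (r c : ℂ) (n : ℕ) :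
    r ^ (n + 1) / Nat.factorial (n + 1) * ((n + 1 : ℕ) * c) =
      r * (r ^ n / Nat.factorial n * c) := by
  have hn : (Nat.factorial n : ℂ) ≠ 0 := by exact_mod_cast n.factorial_ne_zero
  have hn' : ((n + 1 : ℕ) : ℂ) ≠ 0 := by exact_mod_cast n.succ_ne_zero
  rw [Nat.factorial_succ, Nat.cast_mul]
  field_simp
  ring

/-- Multiplying the coefficients of an exponential generating function by the index. -/
theorem hasSum_index_mul {r : ℂ} {c : ℕ → ℂ} {S : ℂ}
    (h : HasSum (fun n : ℕ => r ^ n / Nat.factorial n * c (n + 1)) S) :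
    HasSum (fun n : ℕ => r ^ n / Nat.factorial n * (n * c n)) (r * S) := by
  rw [← hasSum_nat_add_iff' 1]
  simpa only [pow_succ_div_factorial_mul, sum_range_one, Nat.cast_zero, zero_mul, mul_zero,
    sub_zero] using h.mul_left r

/-- The derivative of an exponential generating function. -/
theorem hasDerivAt_tsum_pow_div_factorial {c : ℕ → ℂ} {R : ℝ}
    (hc : Summable fun n : ℕ => (R : ℂ) ^ n / Nat.factorial n * c (n + 1)) {r : ℂ} (hr : ‖r‖ < R) :
    HasDerivAt (fun r : ℂ => ∑' n : ℕ, r ^ n / Nat.factorial n * c n)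
      (∑' n : ℕ, r ^ n / Nat.factorial n * c (n + 1)) r := by
  have hR : 0 < R := (norm_nonneg r).trans_lt hr
  have hshift (n : ℕ) (y : ℂ) : ((n + 1 : ℕ) * y ^ (n + 1 - 1)) / Nat.factorial (n + 1) * c (n + 1) =
      y ^ n / Nat.factorial n * c (n + 1) := by
    have hn : (Nat.factorial n : ℂ) ≠ 0 := by exact_mod_cast n.factorial_ne_zero
    have hn' : ((n + 1 : ℕ) : ℂ) ≠ 0 := by exact_mod_cast n.succ_ne_zero
    rw [Nat.factorial_succ, Nat.cast_mul, Nat.add_sub_cancel]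
    field_simp
  have hu : Summable fun n : ℕ => ‖(n * (R : ℂ) ^ (n - 1)) / Nat.factorial n * c n‖ := by
    rw [← summable_nat_add_iff 1]
    simpa only [hshift] using hc.norm
  have hbound : ∀ (n : ℕ) (y : ℂ), y ∈ Metric.ball (0 : ℂ) R →
      ‖(n * y ^ (n - 1)) / Nat.factorial n * c n‖ ≤
        ‖(n * (R : ℂ) ^ (n - 1)) / Nat.factorial n * c n‖ := by
    intro n y hy
    rw [mem_ball_zero_iff] at hy
    simp only [norm_mul, norm_div, norm_pow, Complex.norm_natCast, Complex.norm_real,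
      Real.norm_of_nonneg hR.le]
    gcongr
  have hr' : r ∈ Metric.ball (0 : ℂ) R := by simpa using hr
  have h := hasDerivAt_tsum_of_isPreconnected hu Metric.isOpen_ball
    (convex_ball (0 : ℂ) R).isPreconnected
    (g := fun (n : ℕ) (y : ℂ) => y ^ n / Nat.factorial n * c n)
    (fun n y _ => ((hasDerivAt_pow n y).div_const _).mul_const _) hbound
    (Metric.mem_ball_self hR)
    (summable_of_ne_finset_zero (s := {0}) fun n hn => by
      rw [zero_pow (by simpa using hn)]
      simp) hr'
  rw [(Summable.of_norm_bounded hu fun n => hbound n r hr').tsum_eq_zero_add] at h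
  simpa only [hshift, Nat.cast_zero, zero_mul, zero_div, zero_add] using h

theorem summable_hermiteC_shift (j : ℕ) (α u : ℂ) :
    Summable fun n : ℕ => α ^ n / Nat.factorial n * hermiteC (j + n) u :=
  (hermiteGrowth_hermiteC u).summable_shift j α

/-- The recurrence in the index `j` of the shifted generating functions of the Hermite
polynomials. -/
theorem tsum_hermiteC_shift_succ (j : ℕ) (α u : ℂ) :
    ∑' n : ℕ, α ^ n / Nat.factorial n * hermiteC (j + 1 + n) u =
      2 * (u - α) * (∑' n : ℕ, α ^ n / Nat.factorial n * hermiteC (j + n) u) -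
        2 * j * ∑' n : ℕ, α ^ n / Nat.factorial n * hermiteC (j - 1 + n) u := by
  have h0 := (summable_hermiteC_shift j α u).hasSum
  have h1 := (summable_hermiteC_shift (j - 1) α u).hasSum
  have h2 := hasSum_index_mul (c := fun n => hermiteC (j + n - 1) u) h0
  have h := ((h0.mul_left (2 * u)).sub (h1.mul_left (2 * (j : ℂ)))).sub (h2.mul_left 2)
  rw [show ∀ a b : ℂ, 2 * (u - α) * a - b = 2 * u * a - b - 2 * (α * a) by intros; ring]
  rw [← h.tsum_eq]
  refine tsum_congr fun n => ?_
  rw [show j + 1 + n = j + n + 1 by omega, hermiteC_succ]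
  rcases j with _ | j
  · push_cast
    ring
  · simp only [show j + 1 + n - 1 = j + n by omega, Nat.add_sub_cancel]
    push_cast
    ring

/-- The exponential generating function of the Hermite polynomials. -/
theorem tsum_hermiteC (α u : ℂ) :
    ∑' n : ℕ, α ^ n / Nat.factorial n * hermiteC n u = Complex.exp (2 * α * u - α ^ 2) := by
  have hd (α : ℂ) : HasDerivAt (fun α : ℂ => ∑' n : ℕ, α ^ n / Nat.factorial n * hermiteC n u)
      (2 * (u - α) * ∑' n : ℕ, α ^ n / Nat.factorial n * hermiteC n u) α := by
    have hs := summable_hermiteC_shift 1 ((‖α‖ + 1 : ℝ) : ℂ) u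
    simp only [add_comm 1] at hs
    have h := hasDerivAt_tsum_pow_div_factorial (c := fun n => hermiteC n u) hs (lt_add_one ‖α‖)
    have e := tsum_hermiteC_shift_succ 0 α u
    simp only [zero_add, Nat.cast_zero, mul_zero, zero_mul, sub_zero, add_comm 1] at e
    rwa [e] at h
  have hg (α : ℂ) : HasDerivAt (fun α : ℂ => Complex.exp (-(2 * α * u - α ^ 2)))
      (Complex.exp (-(2 * α * u - α ^ 2)) * (-(2 * 1 * u - 2 * α))) α := by
    refine (HasDerivAt.sub ?_ ?_).neg.cexp
    · exact ((hasDerivAt_id' α).const_mul 2).mul_const u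
    · simpa using hasDerivAt_pow 2 α
  have hp (α : ℂ) := (hd α).mul (hg α)
  have hc := is_const_of_deriv_eq_zero (fun α => (hp α).differentiableAt)
    (fun α => (hp α).deriv.trans (by ring)) α 0
  have h0 : ∑' n : ℕ, (0 : ℂ) ^ n / Nat.factorial n * hermiteC n u = 1 := by
    rw [tsum_eq_single 0 fun n hn => by simp [hn]]
    simp [hermiteC_zero]
  simp only [Pi.mul_apply, h0, Complex.exp_neg] at hc
  rw [← mul_inv_eq_one₀ (Complex.exp_ne_zero _), hc]
  simp

/-- The shifted exponential generating functions of the Hermite polynomials. -/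
theorem hasSum_hermiteC_shift (j : ℕ) (α u : ℂ) :
    HasSum (fun n : ℕ => α ^ n / Nat.factorial n * hermiteC (j + n) u)
      (Complex.exp (2 * α * u - α ^ 2) * hermiteC j (u - α)) := by
  refine (summable_hermiteC_shift j α u).hasSum_iff.2 ?_
  induction j using Nat.strong_induction_on with
  | _ j ih =>
    rcases j with _ | j
    · simp [tsum_hermiteC, hermiteC_zero]
    · rw [tsum_hermiteC_shift_succ, ih j (by omega), ih (j - 1) (by omega), hermiteC_succ]
      ring

/-- The exponential generating function of products of shifted Hermite polynomials. -/
noncomputable def mehlerSum (x y : ℂ) (a b : ℕ) (r : ℂ) : ℂ :=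
  ∑' n : ℕ, r ^ n / Nat.factorial n * (hermiteC (n + a) x * hermiteC (n + b) y)

theorem hasSum_mehlerSum (x y : ℂ) (a b : ℕ) {r : ℂ} (hr : ‖r‖ < 1 / 2) :
    HasSum (fun n : ℕ => r ^ n / Nat.factorial n * (hermiteC (n + a) x * hermiteC (n + b) y))
      (mehlerSum x y a b r) :=
  ((hermiteGrowth_hermiteC x).summable_mul_shift (hermiteGrowth_hermiteC y) hr a b).hasSum

theorem mehlerSum_comm (x y : ℂ) (a b : ℕ) (r : ℂ) : mehlerSum x y a b r = mehlerSum y x b a r :=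
  tsum_congr fun n => by ring

theorem mehlerSum_one_zero (x y : ℂ) {r : ℂ} (hr : ‖r‖ < 1 / 2) :
    mehlerSum x y 1 0 r = 2 * x * mehlerSum x y 0 0 r - 2 * r * mehlerSum x y 0 1 r := by
  have h := ((hasSum_mehlerSum x y 0 0 hr).mul_left (2 * x)).sub
    ((hasSum_index_mul (c := fun n => hermiteC (n - 1) x * hermiteC n y)
      (hasSum_mehlerSum x y 0 1 hr)).mul_left 2)
  rw [mul_assoc 2 r, ← h.tsum_eq, mehlerSum]
  refine tsum_congr fun n => ?_
  rw [hermiteC_succ]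
  simp only [add_zero]
  ring

theorem mehlerSum_one_one (x y : ℂ) {r : ℂ} (hr : ‖r‖ < 1 / 2) :
    mehlerSum x y 1 1 r = 2 * x * mehlerSum x y 0 1 r -
      2 * r * (2 * y * mehlerSum x y 0 1 r - 2 * mehlerSum x y 0 0 r -
        2 * r * mehlerSum x y 1 1 r) := by
  have h02 : HasSum (fun n : ℕ => r ^ n / Nat.factorial n * (hermiteC n x * hermiteC (n + 2) y))
      (2 * y * mehlerSum x y 0 1 r - 2 * mehlerSum x y 0 0 r - 2 * (r * mehlerSum x y 1 1 r)) := by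
    convert! (((hasSum_mehlerSum x y 0 1 hr).mul_left (2 * y)).sub
      ((hasSum_mehlerSum x y 0 0 hr).mul_left 2)).sub
      ((hasSum_index_mul (c := fun n => hermiteC n x * hermiteC n y)
        (hasSum_mehlerSum x y 1 1 hr)).mul_left 2) using 2 with n
    rw [hermiteC_add_two]
    simp only [add_zero]
    ring
  have h := ((hasSum_mehlerSum x y 0 1 hr).mul_left (2 * x)).sub
    ((hasSum_index_mul (c := fun n => hermiteC (n - 1) x * hermiteC (n + 1) y) h02).mul_left 2)
  rw [mul_assoc 2 r (_ - _), mul_assoc 2 r (mehlerSum x y 1 1 r), ← h.tsum_eq, mehlerSum]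
  refine tsum_congr fun n => ?_
  rw [hermiteC_succ n x]
  simp only [add_zero]
  ring

theorem hasDerivAt_mehlerSum (x y : ℂ) {r : ℂ} (hr : ‖r‖ < 1 / 2) :
    HasDerivAt (mehlerSum x y 0 0) (mehlerSum x y 1 1 r) r := by
  obtain ⟨R, hrR, hR⟩ := exists_between hr
  have hR' : ‖(R : ℂ)‖ < 1 / 2 := by
    rwa [Complex.norm_real, Real.norm_of_nonneg ((norm_nonneg r).trans hrR.le)]
  exact hasDerivAt_tsum_pow_div_factorial (c := fun n => hermiteC n x * hermiteC n y)
    (hasSum_mehlerSum x y 1 1 hR').summable hrR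

/-- The differential equation behind Mehler's formula. -/
theorem mehlerSum_one_one_eq (x y : ℂ) {r : ℂ} (hr : ‖r‖ < 1 / 2) (h : 1 - 4 * r ^ 2 ≠ 0) :
    mehlerSum x y 1 1 r =
      (4 * r / (1 - 4 * r ^ 2) + (4 * x * y * (1 + 4 * r ^ 2) - 8 * r * (x ^ 2 + y ^ 2)) /
        (1 - 4 * r ^ 2) ^ 2) * mehlerSum x y 0 0 r := by
  have h1 := mehlerSum_one_zero x y hr
  have h2 := mehlerSum_one_zero y x hr
  rw [mehlerSum_comm y x 1 0, mehlerSum_comm y x 0 0, mehlerSum_comm y x 0 1] at h2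
  have h3 := mehlerSum_one_one x y hr
  have h01 : (1 - 4 * r ^ 2) * mehlerSum x y 0 1 r = (2 * y - 4 * r * x) * mehlerSum x y 0 0 r := by
    linear_combination h2 - 2 * r * h1
  field_simp
  linear_combination (1 - 4 * r ^ 2) * h3 + (2 * x - 4 * r * y) * h01

/-- Mehler's formula for complex arguments. -/
theorem mehlerSum_eq (x y : ℂ) {w : ℝ} (hw : |w| < 1) :
    mehlerSum x y 0 0 (w / 2) = (√(1 - w ^ 2) : ℂ)⁻¹ *
      Complex.exp ((2 * x * y * w - w ^ 2 * (x ^ 2 + y ^ 2)) / (1 - w ^ 2)) := by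
  have hpos {t : ℝ} (ht : t ∈ Set.Ioo (-1 : ℝ) 1) : 0 < 1 - t ^ 2 := by nlinarith [ht.1, ht.2]
  have hne {t : ℝ} (ht : t ∈ Set.Ioo (-1 : ℝ) 1) : (1 - t ^ 2 : ℂ) ≠ 0 := by
    exact_mod_cast (hpos ht).ne'
  set E : ℝ → ℂ := fun t => (2 * x * y * t - t ^ 2 * (x ^ 2 + y ^ 2)) / (1 - t ^ 2) with hE
  set G : ℝ → ℂ := fun t =>
    mehlerSum x y 0 0 (t / 2) * (√(1 - t ^ 2) : ℂ) * Complex.exp (-E t) with hG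
  have hderiv {t : ℝ} (ht : t ∈ Set.Ioo (-1 : ℝ) 1) : HasDerivAt G 0 t := by
    have hid : HasDerivAt (fun t : ℝ => (t : ℂ)) 1 t := Complex.ofRealCLM.hasDerivAt
    have hr : ‖(t : ℂ) / 2‖ < 1 / 2 := by
      have := abs_lt.2 ht
      simp only [norm_div, Complex.norm_real, Real.norm_eq_abs, Complex.norm_ofNat]
      linarith
    have hM := (hasDerivAt_mehlerSum x y hr).comp t (hid.div_const 2)
    have hq : HasDerivAt (fun t : ℝ => 1 - t ^ 2) (-(2 * t)) t := by
      simpa using (hasDerivAt_pow 2 t).const_sub 1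
    have hS := (hq.sqrt (hpos ht).ne').ofReal_comp
    have hsq : HasDerivAt (fun t : ℝ => (t : ℂ) ^ 2) (2 * t) t :=
      (hid.pow 2).congr_deriv (by simp)
    have hEd := ((hid.const_mul (2 * x * y)).sub (hsq.mul_const (x ^ 2 + y ^ 2))).div
      (hsq.const_sub 1) (hne ht)
    have hG' := (hM.mul hS).mul hEd.neg.cexp
    refine hG'.congr_deriv ?_
    have hs : (√(1 - t ^ 2) : ℂ) ^ 2 = 1 - t ^ 2 := by
      exact_mod_cast Real.sq_sqrt (hpos ht).le
    have hs0 : (√(1 - t ^ 2) : ℂ) ≠ 0 := by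
      exact_mod_cast (Real.sqrt_pos.2 (hpos ht)).ne'
    have h4 : (1 - 4 * ((t : ℂ) / 2) ^ 2) = 1 - t ^ 2 := by ring
    have hode := mehlerSum_one_one_eq x y hr (by rw [h4]; exact hne ht)
    rw [h4] at hode
    have hn := hne ht
    have hds : ((-(2 * t) / (2 * √(1 - t ^ 2)) : ℝ) : ℂ) =
        -t * (√(1 - t ^ 2) : ℂ) / (1 - t ^ 2) := by
      push_cast
      rw [← hs]
      field_simp
    simp only [Function.comp_apply, Pi.mul_apply, Pi.sub_apply, Pi.neg_apply, Pi.div_apply, hode,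
      hds]
    generalize Complex.exp _ = e
    field_simp
    ring
  have hw' : w ∈ Set.Ioo (-1 : ℝ) 1 := abs_lt.1 hw
  have h0 : (0 : ℝ) ∈ Set.Ioo (-1 : ℝ) 1 := by norm_num
  have hconst : G w = G 0 := isOpen_Ioo.is_const_of_deriv_eq_zero isPreconnected_Ioo
    (fun t ht => (hderiv ht).differentiableAt.differentiableWithinAt)
    (fun t ht => (hderiv ht).deriv) hw' h0
  have hM0 : mehlerSum x y 0 0 0 = 1 := by
    rw [mehlerSum, tsum_eq_single 0 fun n hn => by simp [hn]]
    simp [hermiteC_zero]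
  have hs0 : (√(1 - w ^ 2) : ℂ) ≠ 0 := by
    exact_mod_cast (Real.sqrt_pos.2 (hpos hw')).ne'
  have hexp := Complex.exp_ne_zero (E w)
  have hG0 : G 0 = 1 := by simp [hG, hE, hM0]
  rw [hG0] at hconst
  simp only [hG, Complex.exp_neg] at hconst
  change _ = _ * Complex.exp (E w)
  field_simp at hconst ⊢
  linear_combination hconst

/-- Regrouping a triple sum according to the two sums of indices `j + a` and `j + b`. -/
theorem HasSum.sum_range_min {F : ℕ → ℕ → ℕ → ℂ} {S : ℂ}
    (h : HasSum (fun p : ℕ × ℕ × ℕ => F p.1 p.2.1 p.2.2) S) :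
    HasSum (fun p : ℕ × ℕ => ∑ j ∈ range (min p.1 p.2 + 1), F j (p.1 - j) (p.2 - j)) S := by
  let i : ℕ × ℕ × ℕ → (ℕ × ℕ) × ℕ := fun p => ((p.1 + p.2.1, p.1 + p.2.2), p.1)
  let G : (ℕ × ℕ) × ℕ → ℂ := fun q =>
    if q.2 ≤ min q.1.1 q.1.2 then F q.2 (q.1.1 - q.2) (q.1.2 - q.2) else 0
  have hi : Function.Injective i := by
    rintro ⟨j, a, b⟩ ⟨j', a', b'⟩ h
    simp only [i, Prod.mk.injEq] at h ⊢
    omega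
  have hG : HasSum G S := by
    rw [← hi.hasSum_iff]
    · convert! h using 2 with p
      simp [G, i]
    · rintro ⟨⟨m, n⟩, j⟩ hq
      refine if_neg fun hj => hq ⟨(j, m - j, n - j), ?_⟩
      simp only [le_min_iff] at hj
      simp only [i, Nat.add_sub_cancel' hj.1, Nat.add_sub_cancel' hj.2]
  refine hG.prod_fiberwise fun p => ?_
  have hsum : ∑ j ∈ range (min p.1 p.2 + 1), F j (p.1 - j) (p.2 - j) =
      ∑ j ∈ range (min p.1 p.2 + 1), G (p, j) :=
    sum_congr rfl fun j hj => (if_pos (Nat.lt_succ_iff.1 (mem_range.1 hj))).symm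
  rw [hsum]
  exact hasSum_sum_of_ne_finset_zero fun j hj =>
    if_neg fun h => hj (mem_range.2 (Nat.lt_succ_of_le h))

theorem ofReal_Hphys (n : ℕ) (x : ℝ) : (Hphys n x : ℂ) = hermiteC n x := by
  simp [Hphys, hermiteC]

theorem hasSum_hermiteC_triple (u v α β : ℂ) {r : ℂ} (hr : ‖r‖ < 1 / 2) :
    HasSum (fun p : ℕ × ℕ × ℕ => r ^ p.1 / Nat.factorial p.1 *
      ((α ^ p.2.1 / Nat.factorial p.2.1 * hermiteC (p.1 + p.2.1) u) *
        (β ^ p.2.2 / Nat.factorial p.2.2 * hermiteC (p.1 + p.2.2) v)))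
      (Complex.exp (2 * α * u - α ^ 2) * Complex.exp (2 * β * v - β ^ 2) *
        mehlerSum (u - α) (v - β) 0 0 r) := by
  have hs := (hermiteGrowth_hermiteC u).summable_triple (hermiteGrowth_hermiteC v) hr α β
  have hfib (j : ℕ) : HasSum (fun q : ℕ × ℕ => r ^ j / Nat.factorial j *
      ((α ^ q.1 / Nat.factorial q.1 * hermiteC (j + q.1) u) *
        (β ^ q.2 / Nat.factorial q.2 * hermiteC (j + q.2) v)))
      (r ^ j / Nat.factorial j * (Complex.exp (2 * α * u - α ^ 2) * hermiteC j (u - α) *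
        (Complex.exp (2 * β * v - β ^ 2) * hermiteC j (v - β)))) :=
    HasSum.mul_left _ (HasSum.mul (f := fun n : ℕ => α ^ n / Nat.factorial n * hermiteC (j + n) u)
      (g := fun n : ℕ => β ^ n / Nat.factorial n * hermiteC (j + n) v)
      (hasSum_hermiteC_shift j α u) (hasSum_hermiteC_shift j β v)
      (summable_mul_of_summable_norm (f := fun n : ℕ => α ^ n / Nat.factorial n * hermiteC (j + n) u)
        (g := fun n : ℕ => β ^ n / Nat.factorial n * hermiteC (j + n) v)
        (summable_hermiteC_shift j α u).norm (summable_hermiteC_shift j β v).norm))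
  have h1 := hs.hasSum.prod_fiberwise hfib
  have h2 := (hasSum_mehlerSum (u - α) (v - β) 0 0 hr).mul_left
    (Complex.exp (2 * α * u - α ^ 2) * Complex.exp (2 * β * v - β ^ 2))
  have h3 := h2.tsum_eq.symm.trans ((tsum_congr fun j => ?_).trans h1.tsum_eq)
  · rw [h3]
    exact hs.hasSum
  · simp only [add_zero]
    ring

theorem L2D_Hermite2D_mixed_generating_function (s t u v : ℝ) (z z' : ℂ)
    (hst : |s * t| < 1) :
    Summable (fun p : ℕ × ℕ =>
      ‖(s : ℂ) ^ p.1 * (t : ℂ) ^ p.2 /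
          ((Real.sqrt 2 : ℂ) ^ (p.1 + p.2) * (Nat.factorial p.1 : ℂ) *
            (Nat.factorial p.2 : ℂ)) *
        L2D p.1 p.2 z z' * (Hphys p.1 u : ℂ) * (Hphys p.2 v : ℂ)‖) ∧
    ∑' p : ℕ × ℕ,
      (s : ℂ) ^ p.1 * (t : ℂ) ^ p.2 /
          ((Real.sqrt 2 : ℂ) ^ (p.1 + p.2) * (Nat.factorial p.1 : ℂ) *
            (Nat.factorial p.2 : ℂ)) *
        L2D p.1 p.2 z z' * (Hphys p.1 u : ℂ) * (Hphys p.2 v : ℂ) =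
      (Real.sqrt (1 - s ^ 2 * t ^ 2) : ℂ)⁻¹ * Complex.exp
        ((2 * (Real.sqrt 2 : ℂ) *
            ((s : ℂ) * (u : ℂ) * z + (t : ℂ) * (v : ℂ) * z' +
              (s : ℂ) * (t : ℂ) * ((s : ℂ) * (v : ℂ) * z + (t : ℂ) * (u : ℂ) * z')) -
          (s : ℂ) ^ 2 * z ^ 2 - (t : ℂ) ^ 2 * z' ^ 2 -
          4 * (s : ℂ) * (t : ℂ) * (u : ℂ) * (v : ℂ) -
          2 * (s : ℂ) ^ 2 * (t : ℂ) ^ 2 * (z * z' + (u : ℂ) ^ 2 + (v : ℂ) ^ 2)) /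
          (2 * (1 - (s : ℂ) ^ 2 * (t : ℂ) ^ 2))) := by
  have hw : |-(s * t)| < 1 := by rwa [abs_neg]
  have hr : ‖((-(s * t) : ℝ) / 2 : ℂ)‖ < 1 / 2 := by
    rw [norm_div, Complex.norm_real, Real.norm_eq_abs, Complex.norm_ofNat]
    linarith
  have h2 : (√2 : ℂ) ^ 2 = 2 := by exact_mod_cast Real.sq_sqrt (show (0 : ℝ) ≤ 2 by norm_num)
  have h20 : (√2 : ℂ) ≠ 0 := fun h => by simp [h] at h2
  have h := (hasSum_hermiteC_triple u v (s * z / √2) (t * z' / √2) hr).sum_range_min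
    (F := fun j a b => ((-(s * t) : ℝ) / 2 : ℂ) ^ j / Nat.factorial j *
      (((s * z / √2) ^ a / Nat.factorial a * hermiteC (j + a) u) *
        ((t * z' / √2) ^ b / Nat.factorial b * hermiteC (j + b) v)))
  have hterm (p : ℕ × ℕ) :
      (s : ℂ) ^ p.1 * (t : ℂ) ^ p.2 /
          ((Real.sqrt 2 : ℂ) ^ (p.1 + p.2) * (Nat.factorial p.1 : ℂ) *
            (Nat.factorial p.2 : ℂ)) *
        L2D p.1 p.2 z z' * (Hphys p.1 u : ℂ) * (Hphys p.2 v : ℂ) =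
      ∑ j ∈ range (min p.1 p.2 + 1), ((-(s * t) : ℝ) / 2 : ℂ) ^ j / Nat.factorial j *
        (((s * z / √2) ^ (p.1 - j) / Nat.factorial (p.1 - j) * hermiteC (j + (p.1 - j)) u) *
          ((t * z' / √2) ^ (p.2 - j) / Nat.factorial (p.2 - j) * hermiteC (j + (p.2 - j)) v)) := by
    rw [L2D, mul_sum, sum_mul, sum_mul, ofReal_Hphys, ofReal_Hphys]
    refine sum_congr rfl fun j hj => ?_
    obtain ⟨m, n⟩ := p
    simp only [mem_range, Nat.lt_succ_iff, le_min_iff] at hj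
    obtain ⟨a, rfl⟩ := Nat.exists_eq_add_of_le hj.1
    obtain ⟨b, rfl⟩ := Nat.exists_eq_add_of_le hj.2
    have hfac (k : ℕ) : (Nat.factorial k : ℂ) ≠ 0 := by exact_mod_cast k.factorial_ne_zero
    have hm := hfac (j + a)
    have hn := hfac (j + b)
    have h2j : (√2 : ℂ) ^ (j + a + (j + b)) = 2 ^ j * √2 ^ a * √2 ^ b := by
      rw [← h2]
      ring
    simp only [Nat.add_sub_cancel_left, h2j, div_pow, mul_pow, Complex.ofReal_neg,
      Complex.ofReal_mul, neg_pow (s * t : ℂ)]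
    field_simp
    ring
  simp only [hterm]
  refine ⟨h.summable.norm, h.tsum_eq.trans ?_⟩
  rw [mehlerSum_eq _ _ hw, mul_left_comm, ← Complex.exp_add, ← Complex.exp_add]
  have hst2 : s ^ 2 * t ^ 2 < 1 := by
    rw [← mul_pow]
    exact (sq_lt_one_iff_abs_lt_one _).2 hst
  have hne : (1 - s ^ 2 * t ^ 2 : ℂ) ≠ 0 := by exact_mod_cast (sub_pos.2 hst2).ne'
  rw [neg_sq, mul_pow]
  congr 2
  simp only [Complex.ofReal_neg, Complex.ofReal_mul, neg_sq, mul_pow]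
  field_simp
  linear_combination
    (s ^ 2 * z ^ 2 + t ^ 2 * z' ^ 2 + 2 * s ^ 2 * t ^ 2 * z * z' -
      2 * √2 * (s * u * z + t * v * z' + s * t * (s * v * z + t * u * z'))) * h2
end

section
/- For all real numbers σ, τ with |στ| < 1 and all complex numbers z, z', the double series Σ_{k=0}^∞ Σ_{l=0}^∞ (σ^k τ^l / (2^{k+l} k! l!)) L_{2k,2l}(z,z') converges absolutely and equals (1 - στ)^{-1/2} · exp((σ z² + τ z'² - 2 σ τ z z') / (2(1 - στ))). -/
open Finset

open scoped Nat

/-- The Laguerre 2D polynomials with all signs positive, `∑ j, j! C(m,j) C(n,j) z^(m-j) w^(n-j)`,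
defined by recursion on the first index. -/
def posL2D {K : Type*} [CommRing K] (z w : K) : ℕ → ℕ → K
  | 0, n => w ^ n
  | m + 1, n => z * posL2D z w m n + n * posL2D z w m (n - 1)

/-- The Hermite-type polynomials with exponential generating function `exp (s x + τ s² / 2)`. -/
def hermiteTwo {K : Type*} [CommRing K] (τ x : K) : ℕ → K
  | 0 => 1
  | 1 => x
  | m + 2 => x * hermiteTwo τ x (m + 1) + (m + 1) * τ * hermiteTwo τ x m

section CommRing

variable {K : Type*} [CommRing K]

theorem posL2D_succ_right (z w : K) (m n : ℕ) :
    posL2D z w m (n + 1) = w * posL2D z w m n + m * posL2D z w (m - 1) n := by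
  induction m generalizing n with
  | zero => simp [posL2D, pow_succ']
  | succ m ih =>
    have key : z * (m * posL2D z w (m - 1) n) + n * posL2D z w m n
        = n * (w * posL2D z w m (n - 1)) + m * posL2D z w m n := by
      have h1 : (m : K) * posL2D z w m n
          = m * (z * posL2D z w (m - 1) n + n * posL2D z w (m - 1) (n - 1)) := by
        cases m with
        | zero => simp
        | succ m => rfl
      have h2 : (n : K) * posL2D z w m n
          = n * (w * posL2D z w m (n - 1) + m * posL2D z w (m - 1) (n - 1)) := by
        cases n with
        | zero => simp
        | succ n => rw [ih n]; rfl
      linear_combination h2 - h1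
    simp only [posL2D, Nat.add_sub_cancel]
    rw [ih n]
    push_cast
    linear_combination key

theorem posL2D_eq_sum (z w : K) (m n : ℕ) :
    posL2D z w m n = ∑ j ∈ Finset.range (m + 1),
      (m.choose j : K) * n.descFactorial j * z ^ (m - j) * w ^ (n - j) := by
  induction m generalizing n with
  | zero => simp [posL2D]
  | succ m ih =>
    have h1 : z * posL2D z w m n = ∑ j ∈ Finset.range (m + 2),
        (m.choose j : K) * n.descFactorial j * z ^ (m + 1 - j) * w ^ (n - j) := by
      rw [ih, Finset.sum_range_succ _ (m + 1), Finset.mul_sum]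
      simp only [Nat.choose_succ_self, Nat.cast_zero, zero_mul, add_zero]
      refine Finset.sum_congr rfl fun j hj => ?_
      rw [Nat.sub_add_comm (by simpa [Nat.lt_succ_iff] using hj), pow_succ]
      ring
    have h2 : (n : K) * posL2D z w m (n - 1) = ∑ j ∈ Finset.range (m + 1),
        (m.choose j : K) * n.descFactorial (j + 1) * z ^ (m - j) * w ^ (n - (j + 1)) := by
      rw [ih, Finset.mul_sum]
      refine Finset.sum_congr rfl fun j _ => ?_
      cases n with
      | zero => simp
      | succ n =>
        simp only [Nat.succ_descFactorial_succ, Nat.add_sub_add_right]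
        push_cast
        ring
    rw [posL2D, h1, h2, Finset.sum_range_succ', Finset.sum_range_succ' _ (m + 1)]
    simp only [Nat.choose_succ_succ, Nat.choose_zero_right, Nat.add_sub_add_right]
    rw [add_right_comm, ← Finset.sum_add_distrib]
    congr 1
    refine Finset.sum_congr rfl fun j _ => ?_
    push_cast
    ring

end CommRing

theorem L2D_eq_neg_one_pow_mul_posL2D (m n : ℕ) (z w : ℂ) :
    L2D m n z w = (-1) ^ m * posL2D (-z) w m n := by
  rw [posL2D_eq_sum, L2D, Finset.mul_sum]
  refine Finset.sum_subset_zero_on_sdiff (by simp) (fun j hj => ?_) (fun j hj => ?_)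
  · simp only [Finset.mem_sdiff, Finset.mem_range] at hj
    rw [Nat.descFactorial_of_lt (by omega)]
    simp
  · have hj' : j ≤ min m n := by simpa [Nat.lt_succ_iff] using hj
    have hm : j ≤ m := hj'.trans (min_le_left _ _)
    have hn : j ≤ n := hj'.trans (min_le_right _ _)
    have h1 : ((-1 : ℂ)) ^ m * (-z) ^ (m - j) = (-1) ^ j * z ^ (m - j) := by
      obtain ⟨a, rfl⟩ := Nat.exists_eq_add_of_le hm
      rw [Nat.add_sub_cancel_left, pow_add, neg_pow z, mul_assoc, ← mul_assoc ((-1 : ℂ) ^ a),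
        ← mul_pow]
      simp
    have h2 : (n.descFactorial j : ℂ) = n ! / (n - j)! := by
      rw [eq_div_iff (by exact_mod_cast (n - j).factorial_ne_zero), mul_comm]
      exact_mod_cast Nat.factorial_mul_descFactorial hn
    rw [Nat.cast_choose ℂ hm, h2]
    linear_combination (-((m ! : ℂ) / (j ! * (m - j)!) * (n ! / (n - j)!) * w ^ (n - j))) * h1

theorem hermiteTwo_even_odd {K : Type*} [Field K] [CharZero K] (τ x : K) (k : ℕ) :
    hermiteTwo τ x (2 * k) = (2 * k)! * ∑ p ∈ HasAntidiagonal.antidiagonal k,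
      x ^ (2 * p.1) / (2 * p.1)! * ((τ / 2) ^ p.2 / p.2 !) ∧
    hermiteTwo τ x (2 * k + 1) = (2 * k + 1)! * ∑ p ∈ HasAntidiagonal.antidiagonal k,
      x ^ (2 * p.1 + 1) / (2 * p.1 + 1)! * ((τ / 2) ^ p.2 / p.2 !) := by
  have fne (n : ℕ) : (n ! : K) ≠ 0 := by exact_mod_cast n.factorial_ne_zero
  have sne (n : ℕ) : (n + 1 : K) ≠ 0 := by exact_mod_cast n.succ_ne_zero
  have shift (g : ℕ → K) (k : ℕ) : ∑ p ∈ HasAntidiagonal.antidiagonal (k + 1),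
      2 * (p.2 : K) * (g p.1 * ((τ / 2) ^ p.2 / p.2 !)) =
      τ * ∑ p ∈ HasAntidiagonal.antidiagonal k, g p.1 * ((τ / 2) ^ p.2 / p.2 !) := by
    rw [Finset.Nat.sum_antidiagonal_succ', Finset.mul_sum]
    simp only [Nat.cast_zero, mul_zero, zero_mul, zero_add]
    refine Finset.sum_congr rfl fun p _ => ?_
    have := fne p.2
    have := sne p.2
    rw [Nat.factorial_succ]
    push_cast
    field_simp
    ring
  have even_step (k : ℕ) : (2 * (k + 1) : K) * ∑ p ∈ HasAntidiagonal.antidiagonal (k + 1),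
      x ^ (2 * p.1) / (2 * p.1)! * ((τ / 2) ^ p.2 / p.2 !) =
      x * (∑ p ∈ HasAntidiagonal.antidiagonal k,
        x ^ (2 * p.1 + 1) / (2 * p.1 + 1)! * ((τ / 2) ^ p.2 / p.2 !)) +
      τ * ∑ p ∈ HasAntidiagonal.antidiagonal k,
        x ^ (2 * p.1) / (2 * p.1)! * ((τ / 2) ^ p.2 / p.2 !) := by
    rw [← shift (fun a => x ^ (2 * a) / (2 * a)!)]
    have h : x * (∑ p ∈ HasAntidiagonal.antidiagonal k,
        x ^ (2 * p.1 + 1) / (2 * p.1 + 1)! * ((τ / 2) ^ p.2 / p.2 !)) =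
        ∑ p ∈ HasAntidiagonal.antidiagonal (k + 1),
        2 * (p.1 : K) * (x ^ (2 * p.1) / (2 * p.1)! * ((τ / 2) ^ p.2 / p.2 !)) := by
      rw [Finset.Nat.sum_antidiagonal_succ, Finset.mul_sum]
      simp only [Nat.cast_zero, mul_zero, zero_mul, zero_add]
      refine Finset.sum_congr rfl fun p _ => ?_
      have := fne p.2
      have := fne (2 * p.1 + 1)
      have := sne p.1
      rw [show 2 * (p.1 + 1) = (2 * p.1 + 1) + 1 by ring, Nat.factorial_succ (2 * p.1 + 1)]
      push_cast
      rw [show (2 * (p.1 : K) + 1 + 1) = 2 * (p.1 + 1) by ring]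
      field_simp
      ring
    rw [h, ← Finset.sum_add_distrib, Finset.mul_sum]
    refine Finset.sum_congr rfl fun p hp => ?_
    have : (p.1 + p.2 : K) = k + 1 := by exact_mod_cast HasAntidiagonal.mem_antidiagonal.1 hp
    rw [← this]
    ring
  have odd_step (k : ℕ) : (2 * (k + 1) + 1 : K) * ∑ p ∈ HasAntidiagonal.antidiagonal (k + 1),
      x ^ (2 * p.1 + 1) / (2 * p.1 + 1)! * ((τ / 2) ^ p.2 / p.2 !) =
      x * (∑ p ∈ HasAntidiagonal.antidiagonal (k + 1),
        x ^ (2 * p.1) / (2 * p.1)! * ((τ / 2) ^ p.2 / p.2 !)) +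
      τ * ∑ p ∈ HasAntidiagonal.antidiagonal k,
        x ^ (2 * p.1 + 1) / (2 * p.1 + 1)! * ((τ / 2) ^ p.2 / p.2 !) := by
    rw [← shift (fun a => x ^ (2 * a + 1) / (2 * a + 1)!), Finset.mul_sum, Finset.mul_sum,
      ← Finset.sum_add_distrib]
    refine Finset.sum_congr rfl fun p hp => ?_
    have hk : (p.1 + p.2 : K) = k + 1 := by exact_mod_cast HasAntidiagonal.mem_antidiagonal.1 hp
    rw [← hk]
    have := fne p.2
    have := fne (2 * p.1)
    have : (2 * p.1 + 1 : K) ≠ 0 := by exact_mod_cast (2 * p.1).succ_ne_zero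
    rw [Nat.factorial_succ (2 * p.1)]
    push_cast
    field_simp
    ring
  induction k with
  | zero => simp [hermiteTwo]
  | succ k ih =>
    have he : hermiteTwo τ x (2 * (k + 1)) = (2 * (k + 1))! * ∑ p ∈ HasAntidiagonal.antidiagonal (k + 1),
        x ^ (2 * p.1) / (2 * p.1)! * ((τ / 2) ^ p.2 / p.2 !) := by
      rw [show 2 * (k + 1) = 2 * k + 2 by ring, hermiteTwo, ih.1, ih.2,
        Nat.factorial_succ (2 * k + 1)]
      rw [Nat.factorial_succ (2 * k)]
      push_cast
      linear_combination (-((2 * k + 1) * ((2 * k)! : K))) * even_step k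
    refine ⟨he, ?_⟩
    rw [show 2 * (k + 1) + 1 = (2 * k + 1) + 2 by ring, hermiteTwo,
      show 2 * k + 1 + 1 = 2 * (k + 1) by ring, he, ih.2,
      show 2 * k + 1 + 2 = 2 * (k + 1) + 1 by ring, Nat.factorial_succ (2 * (k + 1)),
      show 2 * (k + 1) = 2 * k + 1 + 1 by ring, Nat.factorial_succ (2 * k + 1)]
    have h := odd_step k
    rw [show 2 * k + 1 + 1 = 2 * (k + 1) by ring]
    push_cast
    linear_combination (-((2 * k + 2) * ((2 * k + 1)! : K))) * h

theorem summable_prod_of_nonneg_of_hasSum {α β : Type*} {g : α × β → ℝ} {G : α → ℝ}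
    (hg : 0 ≤ g) (hG : ∀ a, HasSum (fun b => g (a, b)) (G a)) (hs : Summable G) : Summable g := by
  refine (summable_prod_of_nonneg hg).2 ⟨fun a => (hG a).summable, ?_⟩
  simpa only [(hG _).tsum_eq] using hs

theorem hasSum_choose_half (a : ℕ) {y : ℝ} (hy : |y| < 1) :
    HasSum (fun i : ℕ => ((2 * (a + i))! : ℝ) / (4 ^ i * (a + i)! * i !) * y ^ i)
      ((2 * a)! / a ! * ((√(1 - y))⁻¹ * ((1 - y)⁻¹) ^ a)) := by
  have hpos : 0 < 1 - y := by linarith [(abs_lt.1 hy).2]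
  have hb := (Real.one_div_one_sub_rpow_hasFPowerSeriesOnBall_zero (a + 1 / 2)).hasSum
    (y := y) (by simpa [enorm_eq_nnnorm, ← NNReal.coe_lt_coe] using hy)
  have hc := hb.mul_left ((2 * a)! / a ! : ℝ)
  convert! hc using 1
  · funext i
    have hcoef : (i ! : ℝ) * Ring.choose ((a + 1 / 2 : ℝ) + i - 1) i =
        (2 * (a + i))! * a ! / (4 ^ i * (a + i)! * (2 * a)!) := by
      rw [← Ring.multichoose_eq, ← nsmul_eq_mul,
        Ring.factorial_nsmul_multichoose_eq_ascPochhammer,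
        Polynomial.ascPochhammer_smeval_eq_eval]
      induction i with
      | zero =>
        have := (2 * a).factorial_ne_zero
        have := a.factorial_ne_zero
        simp
        field_simp
      | succ i ih =>
        rw [ascPochhammer_succ_eval, ih, ← add_assoc a i 1,
          show 2 * (a + i + 1) = 2 * (a + i) + 1 + 1 by ring, Nat.factorial_succ,
          Nat.factorial_succ, Nat.factorial_succ (a + i)]
        have : (a + i + 1 : ℝ) ≠ 0 := by positivity
        push_cast
        field_simp
        ring
    rw [FormalMultilinearSeries.ofScalars_apply_eq, smul_eq_mul]
    have hi : (i ! : ℝ) ≠ 0 := by positivity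
    rw [← mul_right_inj' hi]
    have : (i ! : ℝ) * ((2 * a)! / a ! * (Ring.choose ((a + 1 / 2 : ℝ) + i - 1) i * y ^ i)) =
      ((2 * a)! / a ! * ((i ! * Ring.choose ((a + 1 / 2 : ℝ) + i - 1) i) * y ^ i)) := by ring
    rw [this, hcoef]
    field_simp
  · rw [zero_add, Real.rpow_add hpos, Real.rpow_natCast, Real.sqrt_eq_rpow, inv_pow]
    field_simp

section RCLike

variable {𝕜 : Type*} [RCLike 𝕜]

theorem hasSum_posL2D (τ z w : 𝕜) (m : ℕ) :
    HasSum (fun l : ℕ => τ ^ l / (2 ^ l * (l ! : 𝕜)) * posL2D z w m (2 * l))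
      (NormedSpace.exp (τ * w ^ 2 / 2) * hermiteTwo τ (z + τ * w) m) := by
  have base : HasSum (fun l : ℕ => τ ^ l / (2 ^ l * (l ! : 𝕜)) * posL2D z w 0 (2 * l))
      (NormedSpace.exp (τ * w ^ 2 / 2)) := by
    convert! NormedSpace.expSeries_div_hasSum_exp (τ * w ^ 2 / 2) using 2 with l
    rw [posL2D, pow_mul, div_pow, mul_pow]
    field_simp
  have step (m : ℕ) {S S' : 𝕜}
      (h : HasSum (fun l : ℕ => τ ^ l / (2 ^ l * (l ! : 𝕜)) * posL2D z w m (2 * l)) S)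
      (h' : HasSum (fun l : ℕ => τ ^ l / (2 ^ l * (l ! : 𝕜)) * (m * posL2D z w (m - 1) (2 * l)))
        S') :
      HasSum (fun l : ℕ => τ ^ l / (2 ^ l * (l ! : 𝕜)) * posL2D z w (m + 1) (2 * l))
        ((z + τ * w) * S + τ * S') := by
    have h1 : HasSum (fun l : ℕ => τ ^ l / (2 ^ l * (l ! : 𝕜)) *
        ((2 * l : ℕ) * posL2D z w m (2 * l - 1))) (τ * (w * S + S')) := by
      rw [← hasSum_nat_add_iff' 1]
      simp only [Finset.range_one, Finset.sum_singleton, mul_zero, Nat.cast_zero, zero_mul,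
        sub_zero]
      refine (((h.mul_left w).add h').mul_left τ).congr_fun ?_
      intro l
      rw [show 2 * (l + 1) - 1 = 2 * l + 1 by omega, posL2D_succ_right, Nat.factorial_succ]
      have : (l ! : 𝕜) ≠ 0 := by exact_mod_cast l.factorial_ne_zero
      have : (l + 1 : 𝕜) ≠ 0 := by exact_mod_cast l.succ_ne_zero
      push_cast
      field_simp
      ring
    convert! (h.mul_left z).add h1 using 1
    · funext l
      rw [posL2D]
      ring
    · ring
  suffices H : ∀ m, HasSum (fun l : ℕ => τ ^ l / (2 ^ l * (l ! : 𝕜)) * posL2D z w m (2 * l))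
      (NormedSpace.exp (τ * w ^ 2 / 2) * hermiteTwo τ (z + τ * w) m) ∧
      HasSum (fun l : ℕ => τ ^ l / (2 ^ l * (l ! : 𝕜)) * posL2D z w (m + 1) (2 * l))
      (NormedSpace.exp (τ * w ^ 2 / 2) * hermiteTwo τ (z + τ * w) (m + 1)) from (H m).1
  intro m
  induction m with
  | zero =>
    refine ⟨by simpa [hermiteTwo] using base, ?_⟩
    convert! step 0 base (S' := 0) (by simp) using 1
    simp [hermiteTwo, mul_comm]
  | succ m ih =>
    refine ⟨ih.2, ?_⟩
    convert! step (m + 1) ih.2 (S' := (m + 1) * (NormedSpace.exp (τ * w ^ 2 / 2) *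
      hermiteTwo τ (z + τ * w) m)) ?_ using 1
    · rw [hermiteTwo]
      ring
    · convert! ih.1.mul_left (m + 1 : 𝕜) using 2 with l
      push_cast
      ring

/-- Terms of the double series obtained by expanding `∑ k, (σ/2)^k / k! * hermiteTwo τ x (2k)`. -/
def hermiteTwoTerm (σ τ x : 𝕜) (p : ℕ × ℕ) : 𝕜 :=
  σ ^ (p.1 + p.2) / (2 ^ (p.1 + p.2) * ((p.1 + p.2)! : 𝕜)) * ((2 * (p.1 + p.2))! *
    (x ^ (2 * p.1) / (2 * p.1)! * ((τ / 2) ^ p.2 / p.2 !)))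

theorem hasSum_hermiteTwoTerm_right {σ τ : ℝ} (h : |σ * τ| < 1) (x : 𝕜) (a : ℕ) :
    HasSum (fun i => hermiteTwoTerm (σ : 𝕜) τ x (a, i))
      (((√(1 - σ * τ))⁻¹ : ℝ) * ((σ * x ^ 2 / (2 * (1 - σ * τ))) ^ a / a !)) := by
  have h1 := ((RCLike.hasSum_ofReal 𝕜).2 (hasSum_choose_half a h)).mul_left
    ((σ / 2) ^ a * x ^ (2 * a) / (2 * a)! : 𝕜)
  have hne : (1 - σ * τ : 𝕜) ≠ 0 := by
    have : 1 - σ * τ ≠ 0 := by linarith [(abs_lt.1 h).2]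
    exact_mod_cast this
  have fne (n : ℕ) : (n ! : 𝕜) ≠ 0 := by exact_mod_cast n.factorial_ne_zero
  convert! h1 using 1
  · funext i
    have := fne (2 * a)
    have := fne i
    have := fne (a + i)
    have e : (4 : 𝕜) ^ i = 2 ^ i * 2 ^ i := by rw [← mul_pow]; norm_num
    simp only [hermiteTwoTerm]
    push_cast
    rw [e, pow_add, pow_add, div_pow, div_pow, mul_pow]
    field_simp
  · have := fne (2 * a)
    have := fne a
    push_cast
    rw [div_pow, div_pow, mul_pow, mul_pow, pow_mul, inv_pow]
    field_simp

theorem summable_hermiteTwoTerm {σ τ : ℝ} (h : |σ * τ| < 1) (x : 𝕜) :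
    Summable (hermiteTwoTerm (σ : 𝕜) τ x) := by
  have h' : |(|σ| * |τ|)| < 1 := by rwa [← abs_mul, abs_abs]
  refine Summable.of_norm_bounded (g := hermiteTwoTerm |σ| |τ| ‖x‖) ?_ fun p => le_of_eq ?_
  · have hr := hasSum_hermiteTwoTerm_right (𝕜 := ℝ) h' ‖x‖
    simp only [RCLike.ofReal_real_eq_id, id] at hr
    have hs := (NormedSpace.expSeries_div_hasSum_exp
      (|σ| * ‖x‖ ^ 2 / (2 * (1 - |σ| * |τ|)))).summable.mul_left (√(1 - |σ| * |τ|))⁻¹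
    refine summable_prod_of_nonneg_of_hasSum (fun p => ?_) hr hs
    simp only [hermiteTwoTerm, Pi.zero_apply]
    positivity
  · simp [hermiteTwoTerm]

theorem hasSum_hermiteTwo {σ τ : ℝ} (h : |σ * τ| < 1) (x : 𝕜) :
    HasSum (fun k : ℕ => (σ : 𝕜) ^ k / (2 ^ k * (k ! : 𝕜)) * hermiteTwo (τ : 𝕜) x (2 * k))
      (((√(1 - σ * τ))⁻¹ : ℝ) * NormedSpace.exp ((σ : 𝕜) * x ^ 2 / (2 * (1 - σ * τ)))) := by
  have hs := (summable_hermiteTwoTerm h x).hasSum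
  have h1 := (NormedSpace.expSeries_div_hasSum_exp
    ((σ : 𝕜) * x ^ 2 / (2 * (1 - σ * τ)))).mul_left (((√(1 - σ * τ))⁻¹ : ℝ) : 𝕜)
  rw [← (hs.prod_fiberwise (hasSum_hermiteTwoTerm_right h x)).unique h1]
  refine (Finset.HasAntidiagonal.sigmaAntidiagonalEquivProd.hasSum_iff.2 hs).sigma fun k => ?_
  convert! hasSum_fintype _ using 1
  rw [(hermiteTwo_even_odd _ _ _).1, Finset.mul_sum, Finset.mul_sum,
    ← Finset.sum_coe_sort (HasAntidiagonal.antidiagonal k)]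
  refine Finset.sum_congr rfl fun p _ => ?_
  have hp := HasAntidiagonal.mem_antidiagonal.1 p.2
  simp [hermiteTwoTerm, hp]

theorem hasSum_posL2D_left {σ τ : ℝ} (h : |σ * τ| < 1) (z w : 𝕜) :
    HasSum (fun k : ℕ => (σ : 𝕜) ^ k / (2 ^ k * (k ! : 𝕜)) *
        (NormedSpace.exp ((τ : 𝕜) * w ^ 2 / 2) * hermiteTwo (τ : 𝕜) (z + τ * w) (2 * k)))
      (((√(1 - σ * τ))⁻¹ : ℝ) * NormedSpace.exp
        (((σ : 𝕜) * z ^ 2 + τ * w ^ 2 + 2 * σ * τ * z * w) / (2 * (1 - σ * τ)))) := by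
  have hne : (1 - σ * τ : 𝕜) ≠ 0 := by
    have : 1 - σ * τ ≠ 0 := by linarith [(abs_lt.1 h).2]
    exact_mod_cast this
  have e : ((σ : 𝕜) * z ^ 2 + τ * w ^ 2 + 2 * σ * τ * z * w) / (2 * (1 - σ * τ)) =
      (τ : 𝕜) * w ^ 2 / 2 + (σ : 𝕜) * (z + τ * w) ^ 2 / (2 * (1 - σ * τ)) := by
    field_simp
    ring
  rw [e, NormedSpace.exp_add]
  convert! (hasSum_hermiteTwo h (z + τ * w)).mul_left
    (NormedSpace.exp ((τ : 𝕜) * w ^ 2 / 2)) using 1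
  · funext k
    ring
  · ring

theorem norm_posL2D_le (z w : 𝕜) (m n : ℕ) : ‖posL2D z w m n‖ ≤ posL2D ‖z‖ ‖w‖ m n := by
  induction m generalizing n with
  | zero => simp [posL2D]
  | succ m ih =>
    simp only [posL2D]
    refine (norm_add_le _ _).trans ?_
    rw [norm_mul, norm_mul, RCLike.norm_natCast]
    gcongr <;> exact ih _

theorem summable_norm_posL2D {σ τ : ℝ} (h : |σ * τ| < 1) (z w : 𝕜) :
    Summable fun p : ℕ × ℕ => ‖(σ : 𝕜) ^ p.1 / (2 ^ p.1 * (p.1 ! : 𝕜)) *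
      ((τ : 𝕜) ^ p.2 / (2 ^ p.2 * (p.2 ! : 𝕜)) * posL2D z w (2 * p.1) (2 * p.2))‖ := by
  have h' : |(|σ| * |τ|)| < 1 := by rwa [← abs_mul, abs_abs]
  refine Summable.of_nonneg_of_le (fun _ => norm_nonneg _)
    (f := fun p : ℕ × ℕ => |σ| ^ p.1 / (2 ^ p.1 * (p.1 ! : ℝ)) *
      (|τ| ^ p.2 / (2 ^ p.2 * (p.2 ! : ℝ)) * posL2D ‖z‖ ‖w‖ (2 * p.1) (2 * p.2)))
    (fun p => ?_) ?_
  · simp only [norm_mul, norm_div, norm_pow, RCLike.norm_ofReal, RCLike.norm_natCast,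
      RCLike.norm_ofNat]
    gcongr
    exact norm_posL2D_le _ _ _ _
  · have hr := (hasSum_posL2D_left (𝕜 := ℝ) h' ‖z‖ ‖w‖).summable
    simp only [RCLike.ofReal_real_eq_id, id] at hr
    have hk (k : ℕ) := (hasSum_posL2D |τ| ‖z‖ ‖w‖ (2 * k)).mul_left
      (|σ| ^ k / (2 ^ k * (k ! : ℝ)))
    refine summable_prod_of_nonneg_of_hasSum (fun p => ?_) hk hr
    have := (norm_nonneg _).trans (norm_posL2D_le z w (2 * p.1) (2 * p.2))
    simp only [Pi.zero_apply]
    positivity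

theorem hasSum_prod_posL2D {σ τ : ℝ} (h : |σ * τ| < 1) (z w : 𝕜) :
    HasSum (fun p : ℕ × ℕ => (σ : 𝕜) ^ p.1 / (2 ^ p.1 * (p.1 ! : 𝕜)) *
        ((τ : 𝕜) ^ p.2 / (2 ^ p.2 * (p.2 ! : 𝕜)) * posL2D z w (2 * p.1) (2 * p.2)))
      (((√(1 - σ * τ))⁻¹ : ℝ) * NormedSpace.exp
        (((σ : 𝕜) * z ^ 2 + τ * w ^ 2 + 2 * σ * τ * z * w) / (2 * (1 - σ * τ)))) := by
  have hs := (summable_norm_posL2D h z w).of_norm.hasSum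
  have hk (k : ℕ) := (hasSum_posL2D (τ : 𝕜) z w (2 * k)).mul_left
    ((σ : 𝕜) ^ k / (2 ^ k * (k ! : 𝕜)))
  have hu := (hs.prod_fiberwise hk).unique (hasSum_posL2D_left h z w)
  rwa [hu] at hs

end RCLike

theorem L2D_even_indices_generating_function (σ τ : ℝ) (z z' : ℂ)
    (hστ : |σ * τ| < 1) :
    Summable (fun p : ℕ × ℕ =>
      ‖(σ : ℂ) ^ p.1 * (τ : ℂ) ^ p.2 /
          (2 ^ (p.1 + p.2) * (Nat.factorial p.1 : ℂ) * (Nat.factorial p.2 : ℂ)) *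
        L2D (2 * p.1) (2 * p.2) z z'‖) ∧
    ∑' p : ℕ × ℕ,
      (σ : ℂ) ^ p.1 * (τ : ℂ) ^ p.2 /
          (2 ^ (p.1 + p.2) * (Nat.factorial p.1 : ℂ) * (Nat.factorial p.2 : ℂ)) *
        L2D (2 * p.1) (2 * p.2) z z' =
      (Real.sqrt (1 - σ * τ) : ℂ)⁻¹ * Complex.exp
        (((σ : ℂ) * z ^ 2 + (τ : ℂ) * z' ^ 2 - 2 * (σ : ℂ) * (τ : ℂ) * z * z') /
          (2 * (1 - (σ : ℂ) * (τ : ℂ)))) := by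
  have hterm (p : ℕ × ℕ) : (σ : ℂ) ^ p.1 * (τ : ℂ) ^ p.2 /
      (2 ^ (p.1 + p.2) * (Nat.factorial p.1 : ℂ) * (Nat.factorial p.2 : ℂ)) *
        L2D (2 * p.1) (2 * p.2) z z' =
      (σ : ℂ) ^ p.1 / (2 ^ p.1 * (p.1 ! : ℂ)) *
        ((τ : ℂ) ^ p.2 / (2 ^ p.2 * (p.2 ! : ℂ)) * posL2D (-z) z' (2 * p.1) (2 * p.2)) := by
    rw [L2D_eq_neg_one_pow_mul_posL2D, pow_mul (-1 : ℂ), neg_one_sq, one_pow, one_mul, pow_add]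
    field_simp
  simp only [hterm]
  refine ⟨summable_norm_posL2D hστ (-z) z', ?_⟩
  refine (hasSum_prod_posL2D hστ (-z) z').tsum_eq.trans ?_
  rw [Complex.exp_eq_exp_ℂ]
  simp only [Complex.coe_algebraMap, RCLike.ofReal_inv]
  congr 2
  ring_nf
end

section
/- For all nonnegative integers m, n, every nonzero complex number t, and all complex numbers z, z', w, w', the series Σ_{k=0}^∞ ((-t)^k / k!) L_{m,k}(z,z') L_{k,n}(w,w') converges absolutely and equals exp(-t w z') · t^n · L_{m,n}(z + t w, z' + w'/t). -/
open Finset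

theorem L2D_eq_sum_choose (m n N : ℕ) (hN : min m n ≤ N) (z z' : ℂ) :
    L2D m n z z' = ∑ j ∈ Finset.range (N + 1),
      (-1 : ℂ) ^ j * (Nat.factorial j : ℂ) * (m.choose j : ℂ) * (n.choose j : ℂ) *
        z ^ (m - j) * z' ^ (n - j) := by
  have hsub : Finset.range (min m n + 1) ⊆ Finset.range (N + 1) :=
    Finset.range_subset_range.2 (by omega)
  rw [L2D, ← Finset.sum_subset hsub]
  · refine Finset.sum_congr rfl fun j hj => ?_
    rw [Finset.mem_range] at hj
    have hf : ∀ i : ℕ, (Nat.factorial i : ℂ) ≠ 0 := fun i =>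
      Nat.cast_ne_zero.2 (Nat.factorial_ne_zero i)
    rw [Nat.cast_choose ℂ (show j ≤ m by omega), Nat.cast_choose ℂ (show j ≤ n by omega)]
    field_simp [hf]
  · intro j _ hj
    rw [Finset.mem_range, not_lt] at hj
    have h : m < j ∨ n < j := by omega
    rcases h with h | h <;> simp [Nat.choose_eq_zero_of_lt h]

theorem L2D_comm (m n : ℕ) (z z' : ℂ) : L2D m n z z' = L2D n m z' z := by
  rw [L2D_eq_sum_choose m n _ le_rfl, L2D_eq_sum_choose n m _ (min_comm m n).ge]
  exact Finset.sum_congr rfl fun j _ => by ring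

theorem L2D_zero_left (n : ℕ) (z z' : ℂ) : L2D 0 n z z' = z' ^ n := by
  simp [L2D_eq_sum_choose 0 n 0 (by simp)]

theorem L2D_succ_left (m n : ℕ) (z z' : ℂ) :
    L2D (m + 1) n z z' = z * L2D m n z z' - n * L2D m (n - 1) z z' := by
  cases n with
  | zero =>
    rw [L2D_comm, L2D_zero_left, L2D_comm m, L2D_zero_left]
    simp [pow_succ']
  | succ n =>
    rw [L2D_eq_sum_choose (m + 1) (n + 1) (n + 1) (by omega),
      L2D_eq_sum_choose m (n + 1) (n + 1) (by omega),
      L2D_eq_sum_choose m (n + 1 - 1) n (by omega),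
      Finset.sum_range_succ', Finset.sum_range_succ' _ (n + 1), mul_add, Finset.mul_sum,
      Finset.mul_sum, add_sub_right_comm, ← Finset.sum_sub_distrib]
    congr 1
    · refine Finset.sum_congr rfl fun j _ => ?_
      have hc : ((n : ℂ) + 1) * n.choose j = (n + 1).choose (j + 1) * ((j : ℂ) + 1) := by
        exact_mod_cast Nat.add_one_mul_choose_eq n j
      have hz : (m.choose (j + 1) : ℂ) * z ^ (m - j) =
          m.choose (j + 1) * (z * z ^ (m - (j + 1))) := by
        rcases le_or_gt (j + 1) m with h | h
        · rw [← pow_succ', show m - (j + 1) + 1 = m - j by omega]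
        · simp [Nat.choose_eq_zero_of_lt h]
      rw [Nat.choose_succ_succ m j, Nat.factorial_succ]
      simp only [Nat.add_sub_add_right, Nat.add_sub_cancel]
      push_cast
      linear_combination
        (-1 : ℂ) ^ (j + 1) * ((j + 1) * j.factorial) * (n + 1).choose (j + 1) * z' ^ (n - j) * hz
        + (-1 : ℂ) ^ j * j.factorial * m.choose j * z ^ (m - j) * z' ^ (n - j) * hc
    · simp [pow_succ']
      ring

theorem L2D_succ_right (m n : ℕ) (z z' : ℂ) :
    L2D m (n + 1) z z' = z' * L2D m n z z' - m * L2D (m - 1) n z z' := by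
  rw [L2D_comm, L2D_succ_left, L2D_comm n, L2D_comm n]

theorem HasSum.of_eq {f g : ℕ → ℂ} {a b : ℂ} (h : HasSum f a) (hfg : ∀ k, g k = f k)
    (hab : b = a) : HasSum g b := by
  rwa [funext hfg, hab]

/-- A series with terms `k c_k g (k - 1) k`, `c_k = (-t) ^ k / k!`, can be shifted by one. -/
theorem hasSum_shift {t s : ℂ} {g : ℕ → ℕ → ℂ}
    (h : HasSum (fun k : ℕ => (-t) ^ k / (Nat.factorial k : ℂ) * g k (k + 1)) s) :
    HasSum (fun k : ℕ => (-t) ^ k / (Nat.factorial k : ℂ) * (k * g (k - 1) k)) (-t * s) := by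
  rw [← hasSum_nat_add_iff' 1]
  refine HasSum.of_eq (h.mul_left (-t)) (fun k => ?_) ?_
  · have hk : (k : ℂ) + 1 ≠ 0 := Nat.cast_add_one_ne_zero k
    have hf : (Nat.factorial k : ℂ) ≠ 0 := Nat.cast_ne_zero.2 (Nat.factorial_ne_zero k)
    rw [Nat.factorial_succ, Nat.add_sub_cancel]
    push_cast
    field_simp
    ring
  · simp

theorem hasSum_L2D_zero_left (n : ℕ) (t z z' w w' : ℂ) :
    HasSum (fun k : ℕ => (-t) ^ k / (Nat.factorial k : ℂ) * (L2D 0 k z z' * L2D k n w w'))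
      (Complex.exp (-t * w * z') * (t * z' + w') ^ n) := by
  induction n with
  | zero =>
    have h := NormedSpace.expSeries_div_hasSum_exp (-t * w * z')
    rw [← Complex.exp_eq_exp_ℂ] at h
    refine HasSum.of_eq h (fun k => ?_) ?_
    · rw [L2D_comm k, L2D_zero_left, L2D_zero_left, mul_pow, mul_pow]
      ring
    · simp
  | succ n ih =>
    have h := hasSum_shift (t := t) (g := fun i j => z' ^ j * L2D i n w w') (by
      refine (ih.mul_left z').of_eq (fun k => ?_) rfl
      rw [L2D_zero_left]
      ring)
    refine HasSum.of_eq ((ih.mul_left w').sub h) (fun k => ?_) ?_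
    · rw [L2D_succ_right, L2D_zero_left]
      ring
    · ring

theorem hasSum_L2D_mul_L2D (m n : ℕ) {t : ℂ} (ht : t ≠ 0) (z z' w w' : ℂ) :
    HasSum (fun k : ℕ => (-t) ^ k / (Nat.factorial k : ℂ) * (L2D m k z z' * L2D k n w w'))
      (Complex.exp (-t * w * z') * t ^ n * L2D m n (z + t * w) (z' + w' / t)) := by
  induction m generalizing n with
  | zero =>
    convert hasSum_L2D_zero_left n t z z' w w' using 1
    rw [L2D_zero_left, mul_assoc, ← mul_pow, mul_add, mul_div_cancel₀ _ ht]
  | succ m ih =>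
    have h := hasSum_shift (t := t) (g := fun i j => L2D m i z z' * L2D j n w w') (by
      refine (((ih n).mul_left w).sub ((ih (n - 1)).mul_left (n : ℂ))).of_eq (fun k => ?_) rfl
      rw [L2D_succ_left k]
      ring)
    refine HasSum.of_eq (((ih n).mul_left z).sub h) (fun k => ?_) ?_
    · rw [L2D_succ_left m]
      ring
    · rw [L2D_succ_left m]
      cases n with
      | zero => simp; ring
      | succ n =>
        rw [Nat.add_sub_cancel]
        ring

theorem L2D_product_sum (m n : ℕ) (t : ℂ) (ht : t ≠ 0) (z z' w w' : ℂ) :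
    Summable (fun k : ℕ =>
      ‖(-t) ^ k / (Nat.factorial k : ℂ) * L2D m k z z' * L2D k n w w'‖) ∧
    ∑' k : ℕ, (-t) ^ k / (Nat.factorial k : ℂ) * L2D m k z z' * L2D k n w w' =
      Complex.exp (-t * w * z') * t ^ n * L2D m n (z + t * w) (z' + w' / t) := by
  have h := hasSum_L2D_mul_L2D m n ht z z' w w'
  simp only [← mul_assoc] at h ⊢
  exact ⟨h.summable.norm, h.tsum_eq⟩
end
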